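/- Assume 0 < τ ≤ a and ξ ≥ 2τ/a. Then there exist constants C > 0 and w > 0, depending only on Ω, a, τ and ξ, such that every smooth solution (u,θ) of the delayed thermoelastic plate with Kelvin–Voigt damping satisfies E(t) ≤ C·e^{−wt}·E(0) for all t ≥ 0. -/

import Mathlib

open MeasureTheory

/-- The Laplacian of a real-valued function on `ℝⁿ` (as a sum of second partial
derivatives along the coordinate directions). -/
noncomputable def lapl (n : ℕ) (f : EuclideanSpace ℝ (Fin n) → ℝ)
    (x : EuclideanSpace ℝ (Fin n)) : ℝ :=
  ∑ i : Fin n, fderiv ℝ (fun y => fderiv ℝ f y (EuclideanSpace.single i 1)) x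
    (EuclideanSpace.single i 1)

/-- A smooth solution of the delayed thermoelastic plate with Kelvin–Voigt damping. -/
structure IsSmoothSolKVPlate (n : ℕ) (Ω : Set (EuclideanSpace ℝ (Fin n))) (τ a : ℝ)
    (u θ : EuclideanSpace ℝ (Fin n) → ℝ → ℝ) : Prop where
  smooth_u : ContDiff ℝ (⊤ : ℕ∞) (fun p : EuclideanSpace ℝ (Fin n) × ℝ => u p.1 p.2)
  smooth_θ : ContDiff ℝ (⊤ : ℕ∞) (fun p : EuclideanSpace ℝ (Fin n) × ℝ => θ p.1 p.2)
  pde_u : ∀ x ∈ Ω, ∀ t > (0 : ℝ),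
    deriv (deriv (u x)) t
      + lapl n (fun y => lapl n (fun z => u z (t - τ)) y) x
      + a * lapl n (fun y => lapl n (fun z => deriv (u z) t) y) x
      + lapl n (fun y => θ y t) x = 0
  pde_θ : ∀ x ∈ Ω, ∀ t > (0 : ℝ),
    deriv (θ x) t - lapl n (fun y => θ y t) x - lapl n (fun y => deriv (u y) t) x = 0
  bc_u : ∀ x ∈ frontier Ω, ∀ t : ℝ, -τ ≤ t → u x t = 0 ∧ lapl n (fun y => u y t) x = 0
  bc_θ : ∀ x ∈ frontier Ω, ∀ t : ℝ, 0 ≤ t → θ x t = 0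

/-- The energy of the delayed thermoelastic plate with Kelvin–Voigt damping. -/
noncomputable def energyKVPlate (n : ℕ) (Ω : Set (EuclideanSpace ℝ (Fin n))) (τ ξ : ℝ)
    (u θ : EuclideanSpace ℝ (Fin n) → ℝ → ℝ) (t : ℝ) : ℝ :=
  (1 / 2) * ((∫ x in Ω, ((deriv (u x) t) ^ 2 + (lapl n (fun y => u y t) x) ^ 2
      + (θ x t) ^ 2))
    + ξ * ∫ x in Ω, ∫ ρ in (0 : ℝ)..(1 : ℝ), (lapl n (fun y => u y (t - τ * ρ)) x) ^ 2)


set_option maxHeartbeats 1000000 in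
lemma consts (τ c0 C : ℝ) (hτ : 0 < τ) (hc : 0 < c0) (hC : 0 < C) :
    ∃ e1 > 0, ∃ e2 > 0, ∃ e3 > 0, ∃ η > 0, ∃ m > (0:ℝ),
      (∀ P N T d A : ℝ, 0 ≤ A → -c0*T^2 - d^2/(2*τ) + e1*(-(τ^3/6)*P^2 + 3*τ^2*d*P + 3*τ*d*N)
        + e2*(C*P^2 - N^2 + N*d + N*T) + e3*(2*τ*N^2 - A) ≤ -η*(T^2+d^2+P^2+N^2+A)) ∧
      (∀ V N T U q : ℝ, U^2 ≤ C*N^2 →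
        m*(V^2+N^2+T^2+q^2) ≤ 1/2*(V^2+N^2+T^2) - e1*(3*τ*N*q) - e2*(U*V) + e3*q^2) := by
  set κ := τ^3/(24*C) with hκ
  have hκ0 : 0 < κ := by positivity
  have hκC : κ*C = τ^3/24 := by rw [hκ]; field_simp
  set B := 54*τ+18*τ^2/κ+2*κ with hB
  have hB0 : 0 < B := by positivity
  obtain ⟨ε, hε, h1, h2, h3, h4, h5⟩ : ∃ ε > 0, ε * B ≤ 1/(4*τ) ∧ 2*κ*ε ≤ c0/2 ∧ 
      18*ε*τ^2 ≤ κ/(16*τ) ∧ ε*(τ^3/24) ≤ 1/4 ∧ ε*κ ≤ 1/2 := by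
    have key : ∀ b c : ℝ, 0 < b → 0 < c → ∀ᶠ ε in nhdsWithin (0:ℝ) (Set.Ioi 0), ε * b ≤ c := by
      intro b c hb hc
      have : Filter.Tendsto (fun ε : ℝ => ε * b) (nhds 0) (nhds 0) := by
        have : Continuous (fun ε : ℝ => ε * b) := by fun_prop
        simpa using this.tendsto 0
      exact ((this.eventually (gt_mem_nhds hc)).filter_mono nhdsWithin_le_nhds).mono fun _ h => le_of_lt h
    obtain ⟨ε, ⟨h0, h1, h2, h3, h4, h5⟩⟩ := ((eventually_mem_nhdsWithin (a := (0:ℝ)) (s := Set.Ioi 0)).and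
      ((key B (1/(4*τ)) hB0 (by positivity)).and 
      ((key (2*κ) (c0/2) (by positivity) (by positivity)).and 
      ((key (18*τ^2) (κ/(16*τ)) (by positivity) (by positivity)).and
      ((key (τ^3/24) (1/4) (by positivity) (by positivity)).and 
      (key κ (1/2) hκ0 (by positivity))))))).exists
    exact ⟨ε, h0, h1, by linarith, by linarith, h4, h5⟩
  refine ⟨ε, hε, κ*ε, by positivity, κ*ε/(8*τ), by positivity,
    min (min (c0/2) (1/(4*τ))) (min (min (ε*τ^3/12) (3/8*κ*ε)) (κ*ε/(8*τ))), by positivity,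
    min (1/4) (κ*ε/(16*τ)), by positivity, ?_, ?_⟩
  · intro P N T d A hA
    set η := min (min (c0/2) (1/(4*τ))) (min (min (ε*τ^3/12) (3/8*κ*ε)) (κ*ε/(8*τ)))
    have e1 : η ≤ c0/2 := (min_le_left _ _).trans (min_le_left _ _)
    have e2 : η ≤ 1/(4*τ) := (min_le_left _ _).trans (min_le_right _ _)
    have e3 : η ≤ ε*τ^3/12 := (min_le_right _ _).trans ((min_le_left _ _).trans (min_le_left _ _))
    have e4 : η ≤ 3/8*κ*ε := (min_le_right _ _).trans ((min_le_left _ _).trans (min_le_right _ _))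
    have e5 : η ≤ κ*ε/(8*τ) := (min_le_right _ _).trans (min_le_right _ _)
    have f1 := mul_le_mul_of_nonneg_right e1 (sq_nonneg T)
    have f2 := mul_le_mul_of_nonneg_right e2 (sq_nonneg d)
    have f3 := mul_le_mul_of_nonneg_right e3 (sq_nonneg P)
    have f4 := mul_le_mul_of_nonneg_right e4 (sq_nonneg N)
    have f5 := mul_le_mul_of_nonneg_right e5 hA
    have g1 : 3*τ^2*d*P ≤ τ^3/24*P^2 + 54*τ*d^2 := by
      have : 0 ≤ τ/24 * (τ*P - 36*d)^2 := by positivity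
      nlinarith
    have g2 : 3*τ*d*N ≤ κ/8*N^2 + 18*τ^2/κ*d^2 := by
      have : 0 ≤ κ/8 * (N - 12*τ/κ*d)^2 := by positivity
      have e : κ/8 * (N - 12*τ/κ*d)^2 = κ/8*N^2 + 18*τ^2/κ*d^2 - 3*τ*d*N := by field_simp; ring
      linarith
    have g3 : N*d ≤ 1/8*N^2+2*d^2 := by nlinarith [sq_nonneg (N-4*d)]
    have g4 : N*T ≤ 1/8*N^2+2*T^2 := by nlinarith [sq_nonneg (N-4*T)]
    have k1 := mul_le_mul_of_nonneg_left (add_le_add g1 g2) hε.le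
    have k2 := mul_le_mul_of_nonneg_left (add_le_add g3 g4) (by positivity : 0 ≤ κ*ε)
    have k3 := mul_le_mul_of_nonneg_right h1 (sq_nonneg d)
    have k4 := mul_le_mul_of_nonneg_right h2 (sq_nonneg T)
    have k5 : κ*ε/(8*τ) * (2*τ*N^2 - A) = κ*ε/4*N^2 - κ*ε/(8*τ)*A := by field_simp; ring
    have k6 : κ*ε*(C*P^2) = ε*(τ^3/24)*P^2 := by rw [← hκC]; ring
    have k7 : d^2/(2*τ) = 2 * (1/(4*τ)*d^2) := by field_simp; ring
    rw [hB] at k3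
    rw [k5, k7]
    generalize 18*τ^2/κ = j at *
    generalize 1/(4*τ) = i at *
    generalize κ*ε/(8*τ) = k at *
    linarith
  · intro V N T U q hU
    set m := min (1/4) (κ*ε/(16*τ))
    have e1 : m ≤ 1/4 := min_le_left _ _
    have e2 : m ≤ κ*ε/(16*τ) := min_le_right _ _
    have f1 := mul_le_mul_of_nonneg_right e1 (sq_nonneg V)
    have f2 := mul_le_mul_of_nonneg_right e1 (sq_nonneg N)
    have f3 := mul_le_mul_of_nonneg_right e1 (sq_nonneg T)
    have f4 := mul_le_mul_of_nonneg_right e2 (sq_nonneg q)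
    have g1 : ε*(3*τ*N*q) ≤ 1/8*N^2+18*ε^2*τ^2*q^2 := by nlinarith [sq_nonneg (N - 12*ε*τ*q)]
    have g2 : U*V ≤ 1/2*(C*N^2+V^2) := by nlinarith [sq_nonneg (U-V)]
    have k1 := mul_le_mul_of_nonneg_left g2 (by positivity : 0 ≤ κ*ε)
    have k2 := mul_le_mul_of_nonneg_right (mul_le_mul_of_nonneg_left h3 hε.le) (sq_nonneg q)
    have k3 := mul_le_mul_of_nonneg_right h4 (sq_nonneg N)
    have k4 := mul_le_mul_of_nonneg_right h5 (sq_nonneg V)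
    have k5 : ε*(κ/(16*τ))*q^2 = κ*ε/(16*τ)*q^2 := by ring
    have k6 : κ*ε*(C*N^2) = ε*(τ^3/24)*N^2 := by rw [← hκC]; ring
    have k7 : κ*ε/(8*τ)*q^2 = 2*(κ*ε/(16*τ)*q^2) := by field_simp; ring
    rw [k7]
    rw [k5] at k2
    generalize κ*ε/(16*τ) = k at *
    have hT := sq_nonneg T
    clear hκC hB0 hU f1 f2 f3 hκ
    have a1 : m*V^2 ≤ 1/4*V^2 := mul_le_mul_of_nonneg_right e1 (sq_nonneg V)
    have a2 : m*N^2 ≤ 1/4*N^2 := mul_le_mul_of_nonneg_right e1 (sq_nonneg N)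
    have a3 : m*T^2 ≤ 1/4*T^2 := mul_le_mul_of_nonneg_right e1 (sq_nonneg T)
    have a4 : κ*ε*(U*V) ≤ 1/2*(1/4*N^2) + 1/2 * (1/2*V^2) := by linarith
    have a5 : ε*(3*τ*N*q) ≤ 1/8*N^2 + k*q^2 := by linarith
    have a6 : m*(V^2+N^2+T^2+q^2) = m*V^2+m*N^2+m*T^2+m*q^2 := by ring
    linarith only [a1,a2,a3,a4,a5,a6,f4,hT]

section abs
variable {H : Type*} [NormedAddCommGroup H] [InnerProductSpace ℝ H] [CompleteSpace H]

lemma prim_hasDerivAt {f : ℝ → H} (hf : Continuous f) (c t : ℝ) :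
    HasDerivAt (fun t => ∫ s in c..t, f s) (f t) t :=
  intervalIntegral.integral_hasDerivAt_right (hf.intervalIntegrable _ _)
    hf.stronglyMeasurable.stronglyMeasurableAtFilter hf.continuousAt

lemma shift_hasDerivAt {F : ℝ → H} {F' : H} {τ t : ℝ} (h : HasDerivAt F F' (t - τ)) :
    HasDerivAt (fun t => F (t - τ)) F' t := by
  exact HasDerivAt.comp_sub_const t τ h

lemma win_hasDerivAt {f : ℝ → H} (hf : Continuous f) (τ t : ℝ) :
    HasDerivAt (fun t => ∫ s in (t-τ)..t, f s) (f t - f (t-τ)) t := by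
  have h := (prim_hasDerivAt hf 0 t).sub (shift_hasDerivAt (prim_hasDerivAt hf 0 (t-τ)))
  refine h.congr_of_eventuallyEq (Filter.Eventually.of_forall fun s => ?_)
  simp only [Pi.sub_apply]
  rw [intervalIntegral.integral_interval_sub_left] <;> exact hf.intervalIntegrable _ _

lemma cs_int {f : ℝ → H} (hf : Continuous f) {s t : ℝ} (hst : s ≤ t) :
    ‖∫ r in s..t, f r‖^2 ≤ (t-s) * ∫ r in s..t, ‖f r‖^2 := by
  rcases hst.eq_or_lt with rfl | hlt
  · simp
  have hl : 0 < t - s := by linarith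
  set I := ∫ r in s..t, f r with hI
  set m := (t-s)⁻¹ • I with hm
  have h0 : 0 ≤ ∫ r in s..t, ‖f r - m‖^2 :=
    intervalIntegral.integral_nonneg hst fun _ _ => by positivity
  have e : ∀ r, ‖f r - m‖^2 = ‖f r‖^2 - 2 * inner ℝ m (f r) + ‖m‖^2 := by
    intro r; rw [norm_sub_sq_real, real_inner_comm]
  simp_rw [e] at h0
  rw [intervalIntegral.integral_add, intervalIntegral.integral_sub, intervalIntegral.integral_const_mul,
    intervalIntegral.integral_const] at h0
  · have e2 : ∫ r in s..t, inner ℝ m (f r) = inner ℝ m I := by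
      have := (innerSL ℝ m).intervalIntegral_comp_comm (hf.intervalIntegrable (μ := volume) s t)
      simpa using this
    rw [e2, hm, norm_smul, inner_smul_left, real_inner_self_eq_norm_sq] at h0
    simp only [norm_inv, Real.norm_eq_abs, abs_of_pos hl, smul_eq_mul, mul_pow] at h0
    have e3 : (t-s) * ((t-s)⁻¹^2 * ‖I‖^2) = (t-s)⁻¹ * ‖I‖^2 := by field_simp
    rw [e3] at h0
    have h1 : (t-s)⁻¹ * ‖I‖^2 ≤ ∫ r in s..t, ‖f r‖^2 := by
      simp at h0; linarith
    rw [inv_mul_le_iff₀ hl] at h1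
    exact h1
  all_goals (apply Continuous.intervalIntegrable; fun_prop)

noncomputable def Wp (w : ℝ → H) (t : ℝ) : H := ∫ s in (0:ℝ)..t, w s
noncomputable def Qf (τ : ℝ) (w : ℝ → H) (t : ℝ) : H :=
  τ • (Wp w t + Wp w (t-τ)) - (2:ℝ) • ∫ s in (t-τ)..t, Wp w s

lemma eq_neg_int {F f : ℝ → H} (hF : ∀ s, HasDerivAt F (f s) s) (hf : Continuous f) (s t : ℝ) :
    ∫ r in s..t, f r = F t - F s :=
  intervalIntegral.integral_eq_sub_of_hasDerivAt (fun x _ => hF x) (hf.intervalIntegrable _ _)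

lemma core_est {w p : ℝ → H} (hw : ∀ t, HasDerivAt w (p t) t) (hp : Continuous p)
    {τ t d : ℝ} (hτ : 0 < τ) (hd : 0 ≤ d) (hd2 : d^2 = τ * ∫ s in (t-τ)..t, ‖p s - p t‖^2) :
    ‖w (t-τ) - w t + τ • p t‖ ≤ d ∧
    ‖Qf τ w t - (τ^3/6) • p t‖ ≤ 3*τ^2*d ∧
    ‖τ • (w t + w (t-τ)) - (2:ℝ) • (Wp w t - Wp w (t-τ))‖ ≤ 3*τ*d := by
  have hwc : Continuous w := continuous_iff_continuousAt.2 fun t => (hw t).continuousAt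
  have hW : ∀ t, HasDerivAt (Wp w) (w t) t := fun t => prim_hasDerivAt hwc 0 t
  have hWc : Continuous (Wp w) := continuous_iff_continuousAt.2 fun t => (hW t).continuousAt
  set W2 : ℝ → H := fun t => ∫ s in (0:ℝ)..t, Wp w s with hW2d
  have hW2 : ∀ t, HasDerivAt W2 (Wp w t) t := fun t => prim_hasDerivAt hWc 0 t
  set φ : ℝ → H := fun s => w s - w t - (s-t) • p t with hφ
  set Φ : ℝ → H := fun s => Wp w s - Wp w t - (s-t) • w t - ((s-t)^2/2) • p t with hΦ
  set Ψ : ℝ → H := fun s => W2 s - (s-t) • Wp w t - ((s-t)^2/2) • w t - ((s-t)^3/6) • p t with hΨ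
  have l1 : ∀ s, HasDerivAt (fun s : ℝ => s - t) 1 s := fun s => (hasDerivAt_id s).sub_const t
  have l2 : ∀ s, HasDerivAt (fun s : ℝ => (s - t)^2/2) (s-t) s := fun s => by
    have := ((l1 s).fun_pow 2).div_const 2
    exact this.congr_deriv (by simp)
  have l3 : ∀ s, HasDerivAt (fun s : ℝ => (s - t)^3/6) ((s-t)^2/2) s := fun s => by
    have := ((l1 s).fun_pow 3).div_const 6
    exact this.congr_deriv (by norm_num; ring)
  have dφ : ∀ s, HasDerivAt φ (p s - p t) s := fun s => by
    have := ((hw s).sub_const (w t)).fun_sub ((l1 s).smul_const (p t))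
    exact this.congr_deriv (by simp [hφ, hΦ])
  have dΦ : ∀ s, HasDerivAt Φ (φ s) s := fun s => by
    have := (((hW s).sub_const (Wp w t)).fun_sub ((l1 s).smul_const (w t))).fun_sub ((l2 s).smul_const (p t))
    exact this.congr_deriv (by simp [hφ, hΦ])
  have dΨ : ∀ s, HasDerivAt Ψ (Φ s) s := fun s => by
    have := (((hW2 s).fun_sub ((l1 s).smul_const (Wp w t))).fun_sub ((l2 s).smul_const (w t))).fun_sub ((l3 s).smul_const (p t))
    exact this.congr_deriv (by simp [hφ, hΦ])
  have cφ : Continuous φ := by fun_prop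
  have cΦ : Continuous Φ := by fun_prop
  have bφ : ∀ s ∈ Set.Icc (t-τ) t, ‖φ s‖ ≤ d := by
    intro s hs
    have e := eq_neg_int dφ (by fun_prop) s t
    have e0 : φ t = 0 := by simp [hφ]
    rw [e0, zero_sub] at e
    have h := cs_int (f := fun r => p r - p t) (by fun_prop) hs.2
    rw [e, norm_neg] at h
    have hmono : ∫ r in s..t, ‖p r - p t‖^2 ≤ ∫ r in (t-τ)..t, ‖p r - p t‖^2 := by
      apply intervalIntegral.integral_mono_interval hs.1 hs.2 le_rfl
      · exact Filter.Eventually.of_forall fun x => by positivity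
      · apply Continuous.intervalIntegrable; fun_prop
    have hnn : 0 ≤ ∫ r in s..t, ‖p r - p t‖^2 :=
      intervalIntegral.integral_nonneg hs.2 fun _ _ => by positivity
    have : ‖φ s‖^2 ≤ d^2 := by
      rw [hd2]
      refine h.trans (mul_le_mul (by linarith [hs.1]) hmono hnn hτ.le)
    exact abs_le_of_sq_le_sq' this hd |>.2
  have bint : ∀ (f : ℝ → H) (B : ℝ), (∀ s ∈ Set.Icc (t-τ) t, ‖f s‖ ≤ B) →
      ∀ s ∈ Set.Icc (t-τ) t, ‖∫ r in s..t, f r‖ ≤ B * τ := by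
    intro f B hB s hs
    have hB0 : 0 ≤ B := (norm_nonneg _).trans (hB s hs)
    refine (intervalIntegral.norm_integral_le_of_norm_le_const (C := B) ?_).trans ?_
    · intro x hx; rw [Set.uIoc_of_le hs.2] at hx
      exact hB x ⟨hs.1.trans hx.1.le, hx.2⟩
    · rw [abs_of_nonneg (by linarith [hs.2])]
      exact mul_le_mul_of_nonneg_left (by linarith [hs.1]) hB0
  have bΦ : ∀ s ∈ Set.Icc (t-τ) t, ‖Φ s‖ ≤ d * τ := by
    intro s hs
    have e := eq_neg_int dΦ cφ s t
    have e0 : Φ t = 0 := by simp [hΦ]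
    rw [e0, zero_sub] at e
    rw [← norm_neg, ← e]
    exact bint φ d bφ s hs
  have hmem : t - τ ∈ Set.Icc (t-τ) t := ⟨le_rfl, by linarith⟩
  refine ⟨?_, ?_, ?_⟩
  · have := bφ _ hmem
    simpa [hφ] using this
  · have e : Qf τ w t - (τ^3/6) • p t = τ • Φ (t-τ) - (2:ℝ) • ∫ r in (t-τ)..t, Φ r := by
      rw [eq_neg_int dΨ cΦ, Qf, eq_neg_int hW2 hWc]
      simp only [hΦ, hΨ]
      module
    rw [e]
    refine (norm_sub_le _ _).trans ?_
    rw [norm_smul, norm_smul, Real.norm_of_nonneg hτ.le, Real.norm_of_nonneg (by norm_num : (0:ℝ) ≤ 2)]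
    have h1 := bΦ _ hmem
    have h2 := bint Φ _ bΦ _ hmem
    nlinarith
  · have e : τ • (w t + w (t-τ)) - (2:ℝ) • (Wp w t - Wp w (t-τ)) =
        τ • φ (t-τ) - (2:ℝ) • ∫ r in (t-τ)..t, φ r := by
      rw [eq_neg_int dΦ cφ]
      simp only [hΦ, hφ]
      module
    rw [e]
    refine (norm_sub_le _ _).trans ?_
    rw [norm_smul, norm_smul, Real.norm_of_nonneg hτ.le, Real.norm_of_nonneg (by norm_num : (0:ℝ) ≤ 2)]
    have h1 := bφ _ hmem
    have h2 := bint φ _ bφ _ hmem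
    nlinarith

/-- the size of `Q` -/
lemma Qf_est {w : ℝ → H} (hwc : Continuous w)
    {τ t q : ℝ} (hτ : 0 < τ) (hq : 0 ≤ q) (hq2 : q^2 = τ * ∫ s in (t-τ)..t, ‖w s‖^2) :
    ‖Qf τ w t‖ ≤ 3*τ*q := by
  have hW : ∀ t, HasDerivAt (Wp w) (w t) t := fun t => prim_hasDerivAt hwc 0 t
  have hWc : Continuous (Wp w) := continuous_iff_continuousAt.2 fun t => (hW t).continuousAt
  have b : ∀ s ∈ Set.Icc (t-τ) t, ‖Wp w s - Wp w t‖ ≤ q := by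
    intro s hs
    have h := cs_int hwc hs.2
    rw [eq_neg_int hW hwc, norm_sub_rev] at h
    have hmono : ∫ r in s..t, ‖w r‖^2 ≤ ∫ r in (t-τ)..t, ‖w r‖^2 := by
      apply intervalIntegral.integral_mono_interval hs.1 hs.2 le_rfl
      · exact Filter.Eventually.of_forall fun x => by positivity
      · apply Continuous.intervalIntegrable; fun_prop
    have hnn : 0 ≤ ∫ r in s..t, ‖w r‖^2 :=
      intervalIntegral.integral_nonneg hs.2 fun _ _ => by positivity
    have : ‖Wp w s - Wp w t‖^2 ≤ q^2 := by
      rw [hq2]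
      refine h.trans (mul_le_mul (by linarith [hs.1]) hmono hnn hτ.le)
    exact abs_le_of_sq_le_sq' this hq |>.2
  have hmem : t - τ ∈ Set.Icc (t-τ) t := ⟨le_rfl, by linarith⟩
  have e : Qf τ w t = τ • (Wp w (t-τ) - Wp w t) - (2:ℝ) • ∫ s in (t-τ)..t, (Wp w s - Wp w t) := by
    rw [intervalIntegral.integral_sub (hWc.intervalIntegrable _ _) (by simp), Qf]
    simp only [intervalIntegral.integral_const]
    module
  have h2 : ‖∫ s in (t-τ)..t, (Wp w s - Wp w t)‖ ≤ q * τ := by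
    refine (intervalIntegral.norm_integral_le_of_norm_le_const (C := q) ?_).trans ?_
    · intro x hx; rw [Set.uIoc_of_le hmem.2] at hx
      exact b x ⟨hx.1.le, hx.2⟩
    · rw [abs_of_nonneg (by linarith)]; simp
  rw [e]
  refine (norm_sub_le _ _).trans ?_
  rw [norm_smul, norm_smul, Real.norm_of_nonneg hτ.le, Real.norm_of_nonneg (by norm_num : (0:ℝ) ≤ 2)]
  have h1 := b _ hmem
  nlinarith



lemma Jf_hasDerivAt {f : ℝ → ℝ} (hf : Continuous f) (τ t : ℝ) :
    HasDerivAt (fun t => τ * Wp f t - ∫ s in (t-τ)..t, Wp f s) (τ * f t - ∫ s in (t-τ)..t, f s) t := by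
  have hW : ∀ t, HasDerivAt (Wp f) (f t) t := fun t => prim_hasDerivAt hf 0 t
  have hWc : Continuous (Wp f) := continuous_iff_continuousAt.2 fun t => (hW t).continuousAt
  rw [eq_neg_int hW hf]
  exact ((hW t).const_mul τ).fun_sub (win_hasDerivAt hWc τ t)

lemma Jf_bounds {f : ℝ → ℝ} (hf : Continuous f) (h0 : ∀ s, 0 ≤ f s) {τ : ℝ} (hτ : 0 < τ) (t : ℝ) :
    0 ≤ τ * Wp f t - ∫ s in (t-τ)..t, Wp f s ∧
    τ * Wp f t - ∫ s in (t-τ)..t, Wp f s ≤ τ * ∫ s in (t-τ)..t, f s := by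
  have hW : ∀ t, HasDerivAt (Wp f) (f t) t := fun t => prim_hasDerivAt hf 0 t
  have hWc : Continuous (Wp f) := continuous_iff_continuousAt.2 fun t => (hW t).continuousAt
  have hmono : Monotone (Wp f) := monotone_of_deriv_nonneg (fun t => (hW t).differentiableAt)
    fun t => by rw [(hW t).deriv]; exact h0 t
  have a1 : ∫ s in (t-τ)..t, Wp f s ≤ ∫ s in (t-τ)..t, Wp f t :=
    intervalIntegral.integral_mono_on (by linarith) (hWc.intervalIntegrable _ _) (by simp)
      fun x hx => hmono hx.2
  have a2 : ∫ s in (t-τ)..t, Wp f (t-τ) ≤ ∫ s in (t-τ)..t, Wp f s :=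
    intervalIntegral.integral_mono_on (by linarith) (by simp) (hWc.intervalIntegrable _ _)
      fun x hx => hmono hx.1
  rw [intervalIntegral.integral_const, smul_eq_mul] at a1 a2
  rw [eq_neg_int hW hf]
  constructor <;> nlinarith

lemma D_eq {w p : ℝ → H} (hw : ∀ t, HasDerivAt w (p t) t) (hp : Continuous p) (τ t : ℝ) :
    ∫ s in (t-τ)..t, ‖p s - p t‖^2 =
      (∫ s in (t-τ)..t, ‖p s‖^2) - 2 * inner ℝ (p t) (w t - w (t-τ)) + τ * ‖p t‖^2 := by
  have e : ∀ r, ‖p r - p t‖^2 = ‖p r‖^2 - 2 * inner ℝ (p t) (p r) + ‖p t‖^2 := by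
    intro r; rw [norm_sub_sq_real, real_inner_comm]
  simp_rw [e]
  rw [intervalIntegral.integral_add, intervalIntegral.integral_sub, intervalIntegral.integral_const_mul,
    intervalIntegral.integral_const]
  · have e2 : ∫ r in (t-τ)..t, inner ℝ (p t) (p r) = inner ℝ (p t) (w t - w (t-τ)) := by
      have := (innerSL ℝ (p t)).intervalIntegral_comp_comm (hp.intervalIntegrable (μ := volume) (t-τ) t)
      rw [eq_neg_int hw hp] at this
      simpa using this
    rw [e2]; simp
  all_goals (apply Continuous.intervalIntegrable; fun_prop)

structure AbsSys (τ a c0 C : ℝ) (u v z w p θ y : ℝ → H) : Prop where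
  hu : ∀ t, HasDerivAt u (v t) t
  hv : ∀ t, HasDerivAt v (z t) t
  hw : ∀ t, HasDerivAt w (p t) t
  hθ : ∀ t, HasDerivAt θ (y t) t
  hp : Continuous p
  e1 : ∀ t > 0, inner ℝ (v t) (z t) = - inner ℝ (p t) (w (t-τ)) - a * ‖p t‖^2 - inner ℝ (p t) (θ t)
  e2 : ∀ t > 0, inner ℝ (θ t) (y t) ≤ - c0 * ‖θ t‖^2 + inner ℝ (p t) (θ t)
  e3 : ∀ t > 0, inner ℝ (u t) (z t) = - inner ℝ (w t) (w (t-τ)) - a * inner ℝ (w t) (p t) - inner ℝ (w t) (θ t)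
  e4 : ∀ t > 0, ‖v t‖^2 ≤ C * ‖p t‖^2
  e5 : ∀ t > 0, ‖u t‖^2 ≤ C * ‖w t‖^2

noncomputable def E0 (v w θ : ℝ → H) (t : ℝ) : ℝ := 1/2 * (‖v t‖^2 + ‖w t‖^2 + ‖θ t‖^2)
noncomputable def E1 (τ a : ℝ) (v w θ : ℝ → H) (t : ℝ) : ℝ :=
  E0 v w θ t + 1/a * ∫ s in (t-τ)..t, ‖w s‖^2

variable {τ a c0 C : ℝ} {u v z w p θ y : ℝ → H}

lemma sq_hasDerivAt {f : ℝ → H} {f' : H} {t : ℝ} (h : HasDerivAt f f' t) :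
    HasDerivAt (fun t => ‖f t‖^2) (2 * inner ℝ (f t) f') t := h.norm_sq

lemma E0_hasDerivAt (S : AbsSys τ a c0 C u v z w p θ y) (t : ℝ) :
    HasDerivAt (E0 v w θ) (inner ℝ (v t) (z t) + inner ℝ (w t) (p t) + inner ℝ (θ t) (y t)) t := by
  have := (((sq_hasDerivAt (S.hv t)).fun_add (sq_hasDerivAt (S.hw t))).fun_add
    (sq_hasDerivAt (S.hθ t))).const_mul (1/2)
  exact this.congr_deriv (by ring)

lemma short_time (hτ : 0 < τ) (ha : 0 < a) (hc : 0 < c0) (S : AbsSys τ a c0 C u v z w p θ y) :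
    ∀ t ∈ Set.Icc 0 τ, E1 τ a v w θ t * Real.exp (-(4/a)*t)
      + a/2 * Real.exp (-(4/a)*τ) * Wp (fun s => ‖p s‖^2) t ≤ E1 τ a v w θ 0 := by
  have hwc : Continuous w := continuous_iff_continuousAt.2 fun t => (S.hw t).continuousAt
  have hp := S.hp
  have dE : ∀ t, HasDerivAt (E1 τ a v w θ) (inner ℝ (v t) (z t) + inner ℝ (w t) (p t) + inner ℝ (θ t) (y t)
      + 1/a * (‖w t‖^2 - ‖w (t-τ)‖^2)) t := fun t =>
    (E0_hasDerivAt S t).fun_add ((win_hasDerivAt (f := fun s => ‖w s‖^2) (by fun_prop) τ t).const_mul (1/a))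
  have dexp : ∀ t, HasDerivAt (fun t : ℝ => Real.exp (-(4/a)*t)) (Real.exp (-(4/a)*t) * (-(4/a))) t := fun t => by
    have := ((hasDerivAt_id t).const_mul (-(4/a))).exp
    simpa using this
  have dX := fun t => ((dE t).fun_mul (dexp t)).fun_add
    ((prim_hasDerivAt (f := fun s => ‖p s‖^2) (by fun_prop) 0 t).const_mul (a/2 * Real.exp (-(4/a)*τ)))
  have hanti : AntitoneOn (fun t => E1 τ a v w θ t * Real.exp (-(4/a)*t)
      + a/2 * Real.exp (-(4/a)*τ) * Wp (fun s => ‖p s‖^2) t) (Set.Icc 0 τ) := by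
    apply antitoneOn_of_deriv_nonpos (convex_Icc _ _)
    · exact fun t _ => (dX t).continuousAt.continuousWithinAt
    · exact fun t _ => (dX t).differentiableAt.differentiableWithinAt
    · intro t ht
      rw [interior_Icc] at ht
      have hd := (dX t).deriv
      refine (le_of_eq hd).trans ?_
      have i1 := S.e1 t ht.1
      have i2 := S.e2 t ht.1
      have c1 : inner ℝ (w t) (p t) ≤ a/4*‖p t‖^2 + 1/a*‖w t‖^2 := by
        have h := real_inner_le_norm (w t) (p t)
        have : 0 ≤ a/4 * (‖p t‖ - 2/a*‖w t‖)^2 := by positivity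
        have e : a/4 * (‖p t‖ - 2/a*‖w t‖)^2 = a/4*‖p t‖^2 + 1/a*‖w t‖^2 - ‖w t‖*‖p t‖ := by
          field_simp; ring
        linarith
      have c2 : -inner ℝ (p t) (w (t-τ)) ≤ a/4*‖p t‖^2 + 1/a*‖w (t-τ)‖^2 := by
        have h := neg_le_of_abs_le (abs_real_inner_le_norm (p t) (w (t-τ)))
        have : 0 ≤ a/4 * (‖p t‖ - 2/a*‖w (t-τ)‖)^2 := by positivity
        have e : a/4 * (‖p t‖ - 2/a*‖w (t-τ)‖)^2 = a/4*‖p t‖^2 + 1/a*‖w (t-τ)‖^2 - ‖p t‖*‖w (t-τ)‖ := by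
          field_simp; ring
        linarith
      have hA : 0 ≤ ∫ s in (t-τ)..t, ‖w s‖^2 :=
        intervalIntegral.integral_nonneg (by linarith) fun _ _ => by positivity
      have hE : 1/2*‖w t‖^2 ≤ E1 τ a v w θ t := by
        unfold E1 E0
        have : 0 ≤ 1/a * ∫ s in (t-τ)..t, ‖w s‖^2 := by positivity
        nlinarith [sq_nonneg ‖v t‖, sq_nonneg ‖θ t‖]
      have hE4 : 2/a * ‖w t‖^2 ≤ 4/a * E1 τ a v w θ t := by
        have := mul_le_mul_of_nonneg_left hE (by positivity : 0 ≤ 4/a)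
        calc _ = 4/a*(1/2*‖w t‖^2) := by ring
          _ ≤ _ := this
      have hT : 0 ≤ c0 * ‖θ t‖^2 := by positivity
      have hmain : inner ℝ (v t) (z t) + inner ℝ (w t) (p t) + inner ℝ (θ t) (y t)
          + 1/a * (‖w t‖^2 - ‖w (t-τ)‖^2) - 4/a * E1 τ a v w θ t ≤ -(a/2)*‖p t‖^2 := by
        have : 2/a*‖w t‖^2 = 1/a*‖w t‖^2+1/a*‖w t‖^2 := by ring
        linarith
      have hex : Real.exp (-(4/a)*τ) ≤ Real.exp (-(4/a)*t) := by
        apply Real.exp_le_exp.2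
        have : 4/a*t ≤ 4/a*τ := mul_le_mul_of_nonneg_left ht.2.le (by positivity)
        linarith
      have k1 := mul_le_mul_of_nonneg_right hmain (Real.exp_pos (-(4/a)*t)).le
      have k2 := mul_le_mul_of_nonneg_left hex (by positivity : 0 ≤ a/2*‖p t‖^2)
      linarith
  intro t ht
  have := hanti (Set.left_mem_Icc.2 hτ.le) ht ht.1
  simpa [Wp] using this

noncomputable def Lyap (τ a e1 e2 e3 : ℝ) (u v w p θ : ℝ → H) (t : ℝ) : ℝ :=
  E0 v w θ t + 1/2 * (τ * Wp (fun s => ‖p s‖^2) t - ∫ s in (t-τ)..t, Wp (fun s => ‖p s‖^2) s)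
    - e1 * inner ℝ (w t) (Qf τ w t) + e2 * (inner ℝ (u t) (v t) + (a-τ)/2 * ‖w t‖^2)
    + e3 * ((τ * Wp (fun s => ‖w s‖^2) t - ∫ s in (t-τ)..t, Wp (fun s => ‖w s‖^2) s)
      + τ * ∫ s in (t-τ)..t, ‖w s‖^2)

lemma Qf_hasDerivAt {w : ℝ → H} (hwc : Continuous w) (τ t : ℝ) :
    HasDerivAt (Qf τ w) (τ • (w t + w (t-τ)) - (2:ℝ) • (Wp w t - Wp w (t-τ))) t := by
  have hW : ∀ t, HasDerivAt (Wp w) (w t) t := fun t => prim_hasDerivAt hwc 0 t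
  have hWc : Continuous (Wp w) := continuous_iff_continuousAt.2 fun t => (hW t).continuousAt
  exact (((hW t).fun_add (shift_hasDerivAt (hW (t-τ)))).const_smul τ).fun_sub
    ((win_hasDerivAt hWc τ t).const_smul (2:ℝ))

lemma Lyap_hasDerivAt (e1 e2 e3 : ℝ) (S : AbsSys τ a c0 C u v z w p θ y) (t : ℝ) :
    HasDerivAt (Lyap τ a e1 e2 e3 u v w p θ)
      (inner ℝ (v t) (z t) + inner ℝ (w t) (p t) + inner ℝ (θ t) (y t)
      + 1/2 * (τ * ‖p t‖^2 - ∫ s in (t-τ)..t, ‖p s‖^2)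
      - e1 * (inner ℝ (w t) (τ • (w t + w (t-τ)) - (2:ℝ) • (Wp w t - Wp w (t-τ))) + inner ℝ (p t) (Qf τ w t))
      + e2 * (inner ℝ (u t) (z t) + inner ℝ (v t) (v t) + (a-τ)/2 * (2 * inner ℝ (w t) (p t)))
      + e3 * (τ * ‖w t‖^2 - (∫ s in (t-τ)..t, ‖w s‖^2) + τ * (‖w t‖^2 - ‖w (t-τ)‖^2))) t := by
  have hwc : Continuous w := continuous_iff_continuousAt.2 fun t => (S.hw t).continuousAt
  have hp := S.hp
  exact ((((E0_hasDerivAt S t).fun_add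
    ((Jf_hasDerivAt (f := fun s => ‖p s‖^2) (by fun_prop) τ t).const_mul (1/2))).fun_sub
    (((S.hw t).inner ℝ (Qf_hasDerivAt hwc τ t)).const_mul e1)).fun_add
    ((((S.hu t).inner ℝ (S.hv t)).fun_add ((sq_hasDerivAt (S.hw t)).const_mul ((a-τ)/2))).const_mul e2)).fun_add
    (((Jf_hasDerivAt (f := fun s => ‖w s‖^2) (by fun_prop) τ t).fun_add
      ((win_hasDerivAt (f := fun s => ‖w s‖^2) (by fun_prop) τ t).const_mul τ)).const_mul e3)

lemma Lyap_deriv_le (hτ : 0 < τ) (hτa : τ ≤ a) {e1 e2 e3 : ℝ} (he1 : 0 < e1) (he2 : 0 < e2) (he3 : 0 < e3)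
    (S : AbsSys τ a c0 C u v z w p θ y) {t d : ℝ} (ht : 0 < t) (hd : 0 ≤ d)
    (hd2 : d^2 = τ * ∫ s in (t-τ)..t, ‖p s - p t‖^2) :
    deriv (Lyap τ a e1 e2 e3 u v w p θ) t ≤ -c0*‖θ t‖^2 - d^2/(2*τ)
        + e1*(-(τ^3/6)*‖p t‖^2 + 3*τ^2*d*‖p t‖ + 3*τ*d*‖w t‖)
        + e2*(C*‖p t‖^2 - ‖w t‖^2 + ‖w t‖*d + ‖w t‖*‖θ t‖)
        + e3*(2*τ*‖w t‖^2 - ∫ s in (t-τ)..t, ‖w s‖^2) := by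
  obtain ⟨b1, b2, b3⟩ := core_est S.hw S.hp hτ hd hd2
  rw [(Lyap_hasDerivAt e1 e2 e3 S t).deriv]
  have hD := D_eq S.hw S.hp τ t
  have hdD : d^2/(2*τ) = 1/2 * ∫ s in (t-τ)..t, ‖p s - p t‖^2 := by
    rw [hd2]; field_simp
  rw [hdD, hD]
  rw [S.e1 t ht, S.e3 t ht, real_inner_self_eq_norm_sq]
  have i2 := S.e2 t ht
  have i4 := S.e4 t ht
  have s1 : inner ℝ (p t) (w t - w (t-τ)) = inner ℝ (w t) (p t) - inner ℝ (p t) (w (t-τ)) := by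
    rw [inner_sub_right, real_inner_comm (p t) (w t)]
  rw [s1]
  -- Psi terms
  have q1 : -inner ℝ (p t) (Qf τ w t) ≤ -(τ^3/6)*‖p t‖^2 + 3*τ^2*d*‖p t‖ := by
    have e : Qf τ w t = (Qf τ w t - (τ^3/6) • p t) + (τ^3/6) • p t := by abel
    rw [e, inner_add_right, inner_smul_right, real_inner_self_eq_norm_sq]
    have h := neg_le_of_abs_le (abs_real_inner_le_norm (p t) (Qf τ w t - (τ^3/6) • p t))
    have h2 := mul_le_mul_of_nonneg_left b2 (norm_nonneg (p t))
    linarith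
  have q2 : -inner ℝ (w t) (τ • (w t + w (t-τ)) - (2:ℝ) • (Wp w t - Wp w (t-τ))) ≤ 3*τ*d*‖w t‖ := by
    have h := neg_le_of_abs_le (abs_real_inner_le_norm (w t) (τ • (w t + w (t-τ)) - (2:ℝ) • (Wp w t - Wp w (t-τ))))
    have h2 := mul_le_mul_of_nonneg_left b3 (norm_nonneg (w t))
    linarith
  have q3 : -inner ℝ (w t) (w (t-τ)) - τ * inner ℝ (w t) (p t) ≤ - ‖w t‖^2 + ‖w t‖*d := by
    have h := neg_le_of_abs_le (abs_real_inner_le_norm (w t) (w (t-τ) - w t + τ • p t))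
    have h2 := mul_le_mul_of_nonneg_left b1 (norm_nonneg (w t))
    rw [inner_add_right, inner_sub_right, inner_smul_right, real_inner_self_eq_norm_sq] at h
    linarith
  have q4 : -inner ℝ (w t) (θ t) ≤ ‖w t‖*‖θ t‖ := by
    have h := neg_le_of_abs_le (abs_real_inner_le_norm (w t) (θ t))
    linarith
  have k1 := mul_le_mul_of_nonneg_left (add_le_add q1 q2) he1.le
  have k2 := mul_le_mul_of_nonneg_left (add_le_add (add_le_add q3 q4) i4) he2.le
  have k3 : 0 ≤ e3 * (τ * ‖w (t-τ)‖^2) := by positivity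
  have k4 : 0 ≤ (a-τ) * ‖p t‖^2 := mul_nonneg (by linarith) (by positivity)
  linarith

set_option maxHeartbeats 2000000 in
theorem abs_stability (hτ : 0 < τ) (hτa : τ ≤ a) (hc : 0 < c0) (hC : 0 < C) :
    ∃ M > 0, ∃ ω > 0, ∀ u v z w p θ y : ℝ → H, AbsSys τ a c0 C u v z w p θ y →
      ∀ t ≥ 0, E1 τ a v w θ t ≤ M * Real.exp (-ω*t) * E1 τ a v w θ 0 := by
  have ha : 0 < a := by linarith
  obtain ⟨e1, he1, e2, he2, e3, he3, η, hη, m, hm, hdis, hlow⟩ := consts τ c0 C hτ hc hC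
  set M1 := 1 + C + τ^2 + e1*(3*τ) + e1*(3*τ*τ) + e2*C + e2*a + e3*(2*τ) with hM1
  have hM1p : 0 < M1 := by positivity
  set M2 := 1 + e1*(3*τ) + e1*(3*τ*τ)*a + e2*C + e2 + e2*a + e3*(2*τ)*a with hM2
  have hM2p : 0 < M2 := by positivity
  set M3 := 1/2 + 1/(a*τ) with hM3
  have hM3p : 0 < M3 := by positivity
  set ω := η/M1 with hω
  have hωp : 0 < ω := by positivity
  set X := Real.exp (4/a*τ) with hX
  have hXp : 0 < X := Real.exp_pos _
  set Y := Real.exp (ω*τ) with hY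
  have hYp : 0 < Y := Real.exp_pos _
  refine ⟨X*Y + (M3/m) * Y * (2*M2*X + τ/a*X), by positivity, ω, hωp, ?_⟩
  intro u v z w p θ y S
  have hwc : Continuous w := continuous_iff_continuousAt.2 fun t => (S.hw t).continuousAt
  have hpc := S.hp
  have cw : Continuous (fun s => ‖w s‖^2) := by fun_prop
  have cp : Continuous (fun s => ‖p s‖^2) := by fun_prop
  have hAnn : ∀ t, 0 ≤ ∫ s in (t-τ)..t, ‖w s‖^2 := fun t =>
        intervalIntegral.integral_nonneg (by linarith) fun _ _ => by positivity
  have hE1nn : ∀ t, 0 ≤ E1 τ a v w θ t := fun t => by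
    unfold E1 E0
    have := hAnn t
    positivity
  have hst := short_time hτ ha hc S
  have hWnn : ∀ t, 0 ≤ t → 0 ≤ Wp (fun s => ‖p s‖^2) t := fun t ht =>
    intervalIntegral.integral_nonneg ht fun _ _ => by positivity
  have hshort : ∀ t ∈ Set.Icc 0 τ, E1 τ a v w θ t ≤ X * E1 τ a v w θ 0 := by
    intro t ht
    have h := hst t ht
    have h2 : 0 ≤ a/2 * Real.exp (-(4/a)*τ) * Wp (fun s => ‖p s‖^2) t :=
      mul_nonneg (by positivity) (hWnn t ht.1)
    have h3 : E1 τ a v w θ t * Real.exp (-(4/a)*t) ≤ E1 τ a v w θ 0 := by linarith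
    have h4 : Real.exp (-(4/a)*τ) ≤ Real.exp (-(4/a)*t) := by
      apply Real.exp_le_exp.2
      have : 4/a*t ≤ 4/a*τ := mul_le_mul_of_nonneg_left ht.2 (by positivity)
      linarith
    have h5 : X * Real.exp (-(4/a)*τ) = 1 := by
      rw [hX, ← Real.exp_add]; simp
    calc E1 τ a v w θ t = E1 τ a v w θ t * (X * Real.exp (-(4/a)*τ)) := by rw [h5, mul_one]
      _ ≤ E1 τ a v w θ t * (X * Real.exp (-(4/a)*t)) := by
          gcongr
          exact hE1nn t
      _ = X * (E1 τ a v w θ t * Real.exp (-(4/a)*t)) := by ring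
      _ ≤ _ := by gcongr
  have hPint : Wp (fun s => ‖p s‖^2) τ ≤ 2/a * X * E1 τ a v w θ 0 := by
    have h := hst τ ⟨hτ.le, le_rfl⟩
    have h2 : 0 ≤ E1 τ a v w θ τ * Real.exp (-(4/a)*τ) := mul_nonneg (hE1nn τ) (Real.exp_pos _).le
    have h5 : X * Real.exp (-(4/a)*τ) = 1 := by
      rw [hX, ← Real.exp_add]; simp
    have h3 : a/2 * Real.exp (-(4/a)*τ) * Wp (fun s => ‖p s‖^2) τ ≤ E1 τ a v w θ 0 := by linarith
    calc Wp (fun s => ‖p s‖^2) τ = 2/a * X * (a/2 * Real.exp (-(4/a)*τ) * Wp (fun s => ‖p s‖^2) τ) := by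
          have : 2/a * X * (a/2 * Real.exp (-(4/a)*τ) * Wp (fun s => ‖p s‖^2) τ) =
            (X * Real.exp (-(4/a)*τ)) * (2/a*(a/2)) * Wp (fun s => ‖p s‖^2) τ := by ring
          rw [this, h5]; field_simp
      _ ≤ _ := by gcongr
  set L := Lyap τ a e1 e2 e3 u v w p θ with hL
  -- common bound of the cross terms
  have hq : ∀ t, ∃ q, 0 ≤ q ∧ q^2 = τ * ∫ s in (t-τ)..t, ‖w s‖^2 := fun t =>
    ⟨_, Real.sqrt_nonneg _, Real.sq_sqrt (mul_nonneg hτ.le (hAnn t))⟩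
  have hcross : ∀ t q, 0 ≤ q → q^2 = τ * (∫ s in (t-τ)..t, ‖w s‖^2) →
      |inner ℝ (w t) (Qf τ w t)| ≤ 3*τ*‖w t‖*q := by
    intro t q h0 h1
    refine (abs_real_inner_le_norm _ _).trans ?_
    have := mul_le_mul_of_nonneg_left (Qf_est hwc hτ h0 h1) (norm_nonneg (w t))
    linarith
  have hup : ∀ t > 0, L t ≤ E0 v w θ t
      + 1/2 * (τ * Wp (fun s => ‖p s‖^2) t - ∫ s in (t-τ)..t, Wp (fun s => ‖p s‖^2) s)
      + e1*(3*τ)*‖w t‖^2 + e1*(3*τ*τ) * (∫ s in (t-τ)..t, ‖w s‖^2)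
      + e2*(C*‖w t‖^2/2 + ‖v t‖^2/2 + a/2*‖w t‖^2)
      + e3*(2*τ)*∫ s in (t-τ)..t, ‖w s‖^2 := by
    intro t ht
    obtain ⟨q, hq0, hq2⟩ := hq t
    have h1 := neg_le_of_abs_le (hcross t q hq0 hq2)
    have h2 : 3*τ*‖w t‖*q ≤ 3*τ*(‖w t‖^2 + q^2) := by
      have : ‖w t‖*q ≤ ‖w t‖^2 + q^2 := by nlinarith [sq_nonneg (‖w t‖-q), sq_nonneg ‖w t‖, sq_nonneg q]
      have := mul_le_mul_of_nonneg_left this (by positivity : 0 ≤ 3*τ)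
      linarith
    rw [hq2] at h2
    have h3 : inner ℝ (u t) (v t) ≤ C*‖w t‖^2/2 + ‖v t‖^2/2 := by
      have := real_inner_le_norm (u t) (v t)
      have := S.e5 t ht
      nlinarith [sq_nonneg (‖u t‖-‖v t‖)]
    have h4 := (Jf_bounds cw (fun s => by positivity) hτ t).2
    have h5 : (a-τ)/2*‖w t‖^2 ≤ a/2*‖w t‖^2 :=
      mul_le_mul_of_nonneg_right (by linarith) (by positivity)
    have k1 := mul_le_mul_of_nonneg_left (show -inner ℝ (w t) (Qf τ w t) ≤ _ by linarith) he1.le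
      (c := 3*τ*(‖w t‖^2 + τ * ∫ s in (t-τ)..t, ‖w s‖^2))
    have k2 := mul_le_mul_of_nonneg_left (add_le_add h3 h5) he2.le
    have k3 := mul_le_mul_of_nonneg_left h4 he3.le
    simp only [hL, Lyap]
    linarith
  have hlo : ∀ t > 0, m * (‖v t‖^2 + ‖w t‖^2 + ‖θ t‖^2 + τ * ∫ s in (t-τ)..t, ‖w s‖^2) ≤ L t := by
    intro t ht
    obtain ⟨q, hq0, hq2⟩ := hq t
    have h := hlow ‖v t‖ ‖w t‖ ‖θ t‖ ‖u t‖ q (S.e5 t ht)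
    rw [hq2] at h
    have h1 := le_of_abs_le (hcross t q hq0 hq2)
    have h3 : -(‖u t‖*‖v t‖) ≤ inner ℝ (u t) (v t) := neg_le_of_abs_le (abs_real_inner_le_norm (u t) (v t))
    have h4 := (Jf_bounds cw (fun s => by positivity) hτ t).1
    have h6 := (Jf_bounds cp (fun s => by positivity) hτ t).1
    have h5 : 0 ≤ (a-τ)/2*‖w t‖^2 := mul_nonneg (by linarith) (by positivity)
    have k1 := mul_le_mul_of_nonneg_left h1 he1.le
    have k2 := mul_le_mul_of_nonneg_left h3 he2.le
    have k3 := mul_nonneg he3.le h4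
    have k4 := mul_nonneg he2.le h5
    simp only [hL, Lyap, E0]
    linarith
  have hE1L : ∀ t > 0, E1 τ a v w θ t ≤ M3/m * L t := by
    intro t ht
    have h := mul_le_mul_of_nonneg_left (hlo t ht) (by positivity : 0 ≤ M3/m)
    refine le_trans ?_ h
    have e : M3/m * (m * (‖v t‖^2 + ‖w t‖^2 + ‖θ t‖^2 + τ * ∫ s in (t-τ)..t, ‖w s‖^2)) =
        (1/2)*(‖v t‖^2 + ‖w t‖^2 + ‖θ t‖^2) + 1/a * (∫ s in (t-τ)..t, ‖w s‖^2)
        + 1/(a*τ) * (‖v t‖^2 + ‖w t‖^2 + ‖θ t‖^2) + 1/2*(τ * ∫ s in (t-τ)..t, ‖w s‖^2) := by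
      rw [hM3]; field_simp; ring
    rw [e]
    have := hAnn t
    have p1 : 0 ≤ 1/(a*τ) * (‖v t‖^2 + ‖w t‖^2 + ‖θ t‖^2) := by positivity
    have p2 : 0 ≤ 1/2*(τ * ∫ s in (t-τ)..t, ‖w s‖^2) := by positivity
    unfold E1 E0
    linarith
  have hLd : ∀ t > 0, deriv L t + ω * L t ≤ 0 := by
    intro t ht
    have hDnn : 0 ≤ ∫ s in (t-τ)..t, ‖p s - p t‖^2 :=
      intervalIntegral.integral_nonneg (by linarith) fun _ _ => by positivity
    obtain ⟨d, hd0, hd2⟩ : ∃ d, 0 ≤ d ∧ d^2 = τ * ∫ s in (t-τ)..t, ‖p s - p t‖^2 :=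
      ⟨_, Real.sqrt_nonneg _, Real.sq_sqrt (mul_nonneg hτ.le hDnn)⟩
    have h1 := (Lyap_deriv_le hτ hτa he1 he2 he3 S ht hd0 hd2).trans
      (hdis ‖p t‖ ‖w t‖ ‖θ t‖ d _ (hAnn t))
    set Sg := ‖θ t‖^2 + d^2 + ‖p t‖^2 + ‖w t‖^2 + ∫ s in (t-τ)..t, ‖w s‖^2 with hSg
    have h2 : L t ≤ M1 * Sg := by
      refine (hup t ht).trans ?_
      have j := (Jf_bounds cp (fun s => by positivity) hτ t).2
      have i4 := S.e4 t ht
      have hPb : τ * ∫ s in (t-τ)..t, ‖p s‖^2 ≤ 2*d^2 + 2*τ^2*‖p t‖^2 := by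
        have : ∫ s in (t-τ)..t, ‖p s‖^2 ≤ ∫ s in (t-τ)..t, (2*‖p s - p t‖^2 + 2*‖p t‖^2) := by
          apply intervalIntegral.integral_mono_on (by linarith) (cp.intervalIntegrable _ _)
          · apply Continuous.intervalIntegrable; fun_prop
          · intro x hx
            have h : ‖p x‖ ≤ ‖p x - p t‖ + ‖p t‖ := by
              simpa using norm_add_le (p x - p t) (p t)
            nlinarith [sq_nonneg (‖p x - p t‖ - ‖p t‖), norm_nonneg (p x)]
        rw [intervalIntegral.integral_add (by apply Continuous.intervalIntegrable; fun_prop) (by simp),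
          intervalIntegral.integral_const_mul, intervalIntegral.integral_const] at this
        have h := mul_le_mul_of_nonneg_left this hτ.le
        rw [hd2]
        simp only [smul_eq_mul, sub_sub_cancel] at h
        linarith
      have n1 : 0 ≤ ‖θ t‖^2 := by positivity
      have n2 : 0 ≤ d^2 := by positivity
      have n3 : 0 ≤ ‖p t‖^2 := by positivity
      have n4 : 0 ≤ ‖w t‖^2 := by positivity
      have n5 := hAnn t
      have i4' := mul_le_mul_of_nonneg_left i4 he2.le
      unfold E0
      rw [hM1, hSg]
      generalize (∫ s in (t-τ)..t, ‖w s‖^2) = A at *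
      generalize ‖θ t‖^2 = T at *
      generalize ‖p t‖^2 = P at *
      generalize ‖w t‖^2 = N at *
      generalize ‖v t‖^2 = V at *
      generalize d^2 = D at *
      have r1 : 0 ≤ (C + τ^2 + e1*(3*τ) + e1*(3*τ*τ) + e2*C + e2*a + e3*(2*τ)) * T := by positivity
      have r2 : 0 ≤ (C + τ^2 + e1*(3*τ) + e1*(3*τ*τ) + e2*C + e2*a + e3*(2*τ)) * D := by positivity
      have r3 : 0 ≤ (1 + e1*(3*τ) + e1*(3*τ*τ) + e2*a + e3*(2*τ)) * P := by positivity
      have r4 : 0 ≤ (C + τ^2 + e1*(3*τ*τ) + e3*(2*τ)) * N := by positivity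
      have r5 : 0 ≤ (1 + C + τ^2 + e1*(3*τ) + e2*C + e2*a) * A := by positivity
      have r6 : 0 ≤ C * P := by positivity
      have r7 : 0 ≤ e2*(C * P) := by positivity
      have r8 : 0 ≤ e2*(C * N) := by positivity
      have r9 : 0 ≤ e2*(a * N) := by positivity
      linarith
    have h3 := mul_le_mul_of_nonneg_left h2 hωp.le
    have h4 : ω * (M1 * Sg) = η * Sg := by rw [hω]; field_simp
    have h1' : deriv L t ≤ -η * Sg := h1
    linarith
  have hLτ : L τ ≤ (2*M2*X + τ/a*X) * E1 τ a v w θ 0 := by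
    have j := (Jf_bounds cp (fun s => by positivity) hτ τ).2
    have j2 : ∫ s in (τ-τ)..τ, ‖p s‖^2 = Wp (fun s => ‖p s‖^2) τ := by rw [sub_self]; rfl
    rw [j2] at j
    have h1 : L τ ≤ 2 * M2 * E1 τ a v w θ τ + τ/2 * Wp (fun s => ‖p s‖^2) τ := by
      refine (hup τ hτ).trans ?_
      have n1 : 0 ≤ ‖θ τ‖^2 := by positivity
      have n3 : 0 ≤ ‖v τ‖^2 := by positivity
      have n4 : 0 ≤ ‖w τ‖^2 := by positivity
      have n5 := hAnn τ
      unfold E1 E0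
      rw [hM2]
      have g : ∀ k : ℝ, k*a*(1/a * ∫ s in (τ-τ)..τ, ‖w s‖^2) = k * ∫ s in (τ-τ)..τ, ‖w s‖^2 := by
        intro k; field_simp
      have g1 := g (e1*(3*τ*τ))
      have g2 := g (e3*(2*τ))
      have n6 : 0 ≤ 1/a * ∫ s in (τ-τ)..τ, ‖w s‖^2 := by positivity
      generalize 1/a * (∫ s in (τ-τ)..τ, ‖w s‖^2) = B at *
      generalize (∫ s in (τ-τ)..τ, ‖w s‖^2) = A at *
      generalize ‖θ τ‖^2 = T at *
      generalize ‖w τ‖^2 = N at *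
      generalize ‖v τ‖^2 = V at *
      rw [← g1, ← g2]
      have r1 : 0 ≤ (1/2 + e1*(3*τ) + e1*(3*τ*τ)*a + e2*C + e2 + e2*a + e3*(2*τ)*a)*T := by positivity
      have r2 : 0 ≤ (1 + e1*(3*τ) + e1*(3*τ*τ)*a + e2*C + e2 + e2*a + e3*(2*τ)*a)*B := by positivity
      have r2' : 0 ≤ (1 + e1*(3*τ) + e2*C + e2 + e2*a)*B := by positivity
      have r3 : 0 ≤ (1/2 + e1*(3*τ) + e1*(3*τ*τ)*a + e2*C + e2*a + e3*(2*τ)*a)*V := by positivity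
      have r3' : 0 ≤ e2*V := by positivity
      have r4 : 0 ≤ (1/2 + e1*(3*τ*τ)*a + e2 + e3*(2*τ)*a)*N := by positivity
      have r5 : 0 ≤ (e2*C + e2*a)*N := by positivity
      have r6 : 0 ≤ 1/2*T := by positivity
      have r7 : 0 ≤ (1 + e1*(3*τ) + e1*(3*τ*τ)*a + e2*C + e2 + e2*a + e3*(2*τ)*a)*N := by positivity
      linarith
    have h2 := hshort τ ⟨hτ.le, le_rfl⟩
    have h3 := mul_le_mul_of_nonneg_left h2 (by positivity : 0 ≤ 2*M2)
    have h4 := mul_le_mul_of_nonneg_left hPint (by positivity : 0 ≤ τ/2)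
    have e : τ/2 * (2/a*X*E1 τ a v w θ 0) = τ/a*X*E1 τ a v w θ 0 := by field_simp
    linarith
  have hanti : AntitoneOn (fun t => L t * Real.exp (ω*t)) (Set.Ici τ) := by
    have dexp : ∀ t, HasDerivAt (fun t : ℝ => Real.exp (ω*t)) (Real.exp (ω*t) * ω) t := fun t => by
      have := ((hasDerivAt_id t).const_mul ω).exp
      simpa using this
    have dL : ∀ t, HasDerivAt L (deriv L t) t := fun t =>
      (Lyap_hasDerivAt e1 e2 e3 S t).differentiableAt.hasDerivAt
    have dX := fun t => (dL t).fun_mul (dexp t)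
    apply antitoneOn_of_deriv_nonpos (convex_Ici _)
    · exact fun t _ => (dX t).continuousAt.continuousWithinAt
    · exact fun t _ => (dX t).differentiableAt.differentiableWithinAt
    · intro t ht
      rw [interior_Ici] at ht
      rw [(dX t).deriv]
      have h := mul_le_mul_of_nonneg_right (hLd t (hτ.trans ht)) (Real.exp_pos (ω*t)).le
      linarith
  intro t ht
  have h0 := hE1nn 0
  have hexp : Y * Real.exp (-ω*t) = Real.exp (ω*(τ-t)) := by
    rw [hY, ← Real.exp_add]; congr 1; ring
  rcases le_total t τ with htτ | htτ
  · have h1 := hshort t ⟨ht, htτ⟩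
    have h2 : 1 ≤ Y * Real.exp (-ω*t) := by
      rw [hexp]; exact Real.one_le_exp (mul_nonneg hωp.le (by linarith))
    have h3 : X * E1 τ a v w θ 0 * 1 ≤ X * E1 τ a v w θ 0 * (Y * Real.exp (-ω*t)) :=
      mul_le_mul_of_nonneg_left h2 (by positivity)
    have h4 : 0 ≤ (M3/m) * Y * (2*M2*X + τ/a*X) * Real.exp (-ω*t) * E1 τ a v w θ 0 := by positivity
    linarith
  · have h1 := hE1L t (hτ.trans_le htτ)
    have h2 : L t * Real.exp (ω*t) ≤ L τ * Y := hanti (Set.mem_Ici.2 le_rfl) htτ htτ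
    have h5 : Real.exp (ω*t) * Real.exp (-ω*t) = 1 := by rw [← Real.exp_add]; simp
    have h3 : L t ≤ L τ * Y * Real.exp (-ω*t) := by
      have := mul_le_mul_of_nonneg_right h2 (Real.exp_pos (-ω*t)).le
      rwa [mul_assoc, h5, mul_one] at this
    have h4 : L τ * Y * Real.exp (-ω*t) ≤ (2*M2*X + τ/a*X) * E1 τ a v w θ 0 * Y * Real.exp (-ω*t) := by
      gcongr
    have h6 := mul_le_mul_of_nonneg_left (h3.trans h4) (by positivity : 0 ≤ M3/m)
    have h7 : 0 ≤ X*Y*Real.exp (-ω*t) * E1 τ a v w θ 0 := by positivity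
    linarith
end abs

section green
variable {n : ℕ} {Ω : Set (EuclideanSpace ℝ (Fin n))}

lemma seg_frontier {X : Type*} [NormedAddCommGroup X] [NormedSpace ℝ X] {Ω : Set X} {x y : X} (hx : x ∈ Ω) (hy : y ∉ Ω) :
    ∃ z ∈ frontier Ω, ‖x - z‖ ≤ ‖x - y‖ := by
  have hc : IsPreconnected (segment ℝ x y) := (convex_segment x y).isPreconnected
  have : (segment ℝ x y ∩ frontier Ω).Nonempty := by
    by_contra hne
    rw [Set.not_nonempty_iff_eq_empty] at hne
    have hsub : segment ℝ x y ⊆ interior Ω ∪ (closure Ω)ᶜ := by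
      intro z hz
      by_cases h1 : z ∈ interior Ω
      · exact Or.inl h1
      · refine Or.inr fun h2 => ?_
        have : z ∈ segment ℝ x y ∩ frontier Ω := ⟨hz, h2, h1⟩
        rw [hne] at this; exact this
    have h1 : x ∈ interior Ω := by
      rcases hsub (left_mem_segment ℝ x y) with h | h
      · exact h
      · exact absurd (subset_closure hx) h
    have h2 : y ∈ (closure Ω)ᶜ := by
      rcases hsub (right_mem_segment ℝ x y) with h | h
      · exact absurd (interior_subset h) hy
      · exact h
    obtain ⟨z, _, hz1, hz2⟩ := hc _ _ isOpen_interior isClosed_closure.isOpen_compl hsub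
      ⟨x, left_mem_segment ℝ x y, h1⟩ ⟨y, right_mem_segment ℝ x y, h2⟩
    exact hz2 (subset_closure (interior_subset hz1))
  obtain ⟨z, hz, hf⟩ := this
  refine ⟨z, hf, ?_⟩
  rw [segment_eq_image'] at hz
  obtain ⟨s, hs, rfl⟩ := hz
  simp only [sub_add_cancel_left, norm_neg, norm_smul, Real.norm_eq_abs, abs_of_nonneg hs.1]
  rw [norm_sub_rev x y]
  exact mul_le_of_le_one_left (norm_nonneg _) hs.2

lemma integral_fderiv_zero (ho : IsOpen Ω) (hb : Bornology.IsBounded Ω)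
    {h : EuclideanSpace ℝ (Fin n) → ℝ} (hs : ContDiff ℝ 1 h) (h0 : ∀ x ∈ frontier Ω, h x = 0)
    (v : EuclideanSpace ℝ (Fin n)) : ∫ x in Ω, fderiv ℝ h x v = 0 := by
  classical
  rcases eq_or_ne v 0 with rfl | hv
  · simp
  obtain ⟨R, hR⟩ := hb.subset_closedBall (0 : EuclideanSpace ℝ (Fin n))
  obtain ⟨K, hK⟩ := (hs.contDiffOn (s := Metric.closedBall 0 R)).exists_lipschitzOnWith one_ne_zero
    (convex_closedBall _ _) (isCompact_closedBall _ _)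
  have hcl : closure Ω ⊆ Metric.closedBall 0 R := closure_minimal hR Metric.isClosed_closedBall
  set F : EuclideanSpace ℝ (Fin n) → ℝ := Ω.indicator h with hF
  have key : ∀ x ∈ Ω, ∀ y ∉ Ω, |h x| ≤ K * ‖x - y‖ := by
    intro x hx y hy
    obtain ⟨z, hz, hzl⟩ := seg_frontier hx hy
    have := hK.dist_le_mul x (hR hx) z (hcl hz.1)
    rw [h0 z hz, Real.dist_eq, sub_zero, dist_eq_norm] at this
    exact this.trans (mul_le_mul_of_nonneg_left hzl K.2)
  have hFL : LipschitzWith K F := by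
    apply LipschitzWith.of_dist_le_mul
    intro x y
    by_cases hx : x ∈ Ω <;> by_cases hy : y ∈ Ω
    · simp only [hF, Set.indicator_of_mem hx, Set.indicator_of_mem hy]
      exact hK.dist_le_mul x (hR hx) y (hR hy)
    · simp only [hF, Set.indicator_of_mem hx, Set.indicator_of_notMem hy]
      rw [Real.dist_eq, sub_zero, dist_eq_norm]; exact key x hx y hy
    · simp only [hF, Set.indicator_of_mem hy, Set.indicator_of_notMem hx]
      rw [dist_comm, dist_comm x y, Real.dist_eq, sub_zero, dist_eq_norm]; exact key y hy x hx
    · simp only [hF, Set.indicator_of_notMem hy, Set.indicator_of_notMem hx]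
      simp; positivity
  have hcs : HasCompactSupport F := by
    refine HasCompactSupport.of_support_subset_isCompact (isCompact_closedBall 0 R) ?_
    exact (Set.support_indicator_subset).trans hR
  have hI := LipschitzWith.integral_lineDeriv_mul_eq (μ := volume) (LipschitzWith.const (1:ℝ)) hFL hcs (-v)
  have hlc : ∀ x : EuclideanSpace ℝ (Fin n), ∀ w : EuclideanSpace ℝ (Fin n),
      lineDeriv ℝ (fun _ : EuclideanSpace ℝ (Fin n) => (1:ℝ)) x w = 0 := by
    intro x w; simp [lineDeriv]
  simp only [hlc, zero_mul, integral_zero, neg_neg, mul_one] at hI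
  -- off Ω
  have hoff : ∀ᵐ x ∂(volume.restrict Ωᶜ), lineDeriv ℝ F x v = 0 := by
    set s : Set (EuclideanSpace ℝ (Fin n)) := Ωᶜ with hsd
    have hdiff : ∀ᵐ x ∂volume, DifferentiableAt ℝ F x := hFL.ae_differentiableAt
    set s' : Set (EuclideanSpace ℝ (Fin n)) := s ∩ {x | DifferentiableAt ℝ F x} with hs'
    have hm : MeasurableSet s' := ho.measurableSet.compl.inter (measurableSet_of_differentiableAt ℝ F)
    have happ : ApproximatesLinearOn (fun x => F x • v) (0 : EuclideanSpace ℝ (Fin n) →L[ℝ] EuclideanSpace ℝ (Fin n)) s' 0 := by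
      intro x hx y hy
      have e1 : F x = 0 := Set.indicator_of_notMem hx.1 _
      have e2 : F y = 0 := Set.indicator_of_notMem hy.1 _
      simp [e1, e2]
    have := happ.norm_fderiv_sub_le volume hm (fun x => (fderiv ℝ F x).smulRight v) (fun x hx => by
      have hd : DifferentiableAt ℝ F x := hx.2
      exact (hd.hasFDerivAt.smul_const v).hasFDerivWithinAt)
    rw [ae_restrict_iff' hm] at this
    rw [ae_restrict_iff' ho.measurableSet.compl]
    filter_upwards [this, hdiff] with x h1 h2 hx
    have h3 := h1 ⟨hx, h2⟩
    rw [h2.lineDeriv_eq_fderiv]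
    have h4 : fderiv ℝ F x = 0 ∨ v = 0 := by simpa using h3
    rcases h4 with h4 | h4
    · rw [h4]; simp
    · exact absurd h4 hv
  have hon : ∀ x ∈ Ω, lineDeriv ℝ F x v = fderiv ℝ h x v := by
    intro x hx
    have he : F =ᶠ[nhds x] h := by
      filter_upwards [ho.mem_nhds hx] with y hy
      exact Set.indicator_of_mem hy _
    rw [he.lineDeriv_eq, (hs.differentiable one_ne_zero x).lineDeriv_eq_fderiv]
  have hsplit : ∫ x, lineDeriv ℝ F x v = ∫ x in Ω, lineDeriv ℝ F x v := by
    symm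
    apply setIntegral_eq_integral_of_ae_compl_eq_zero
    rw [ae_restrict_iff' ho.measurableSet.compl] at hoff
    exact hoff
  rw [← setIntegral_congr_fun ho.measurableSet hon, ← hsplit]
  exact hI.symm

lemma integrableOn_of_cont (hb : Bornology.IsBounded Ω)
    {f : EuclideanSpace ℝ (Fin n) → ℝ} (hf : Continuous f) : IntegrableOn f Ω := by
  have : IsCompact (closure Ω) := hb.isCompact_closure
  exact (hf.continuousOn.integrableOn_compact this).mono_set subset_closure

/-- directional derivative -/
noncomputable def dd {X : Type*} [NormedAddCommGroup X] [NormedSpace ℝ X] (v : X) (f : X → ℝ) : X → ℝ :=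
  fun x => fderiv ℝ f x v

lemma dd_smooth {X : Type*} [NormedAddCommGroup X] [NormedSpace ℝ X] (v : X) {f : X → ℝ}
    (hf : ContDiff ℝ (⊤ : ℕ∞) f) : ContDiff ℝ (⊤ : ℕ∞) (dd v f) := by
  unfold dd
  exact (hf.fderiv_right (m := (⊤ : ℕ∞)) (by simp)).clm_apply contDiff_const

lemma dd_comm {X : Type*} [NormedAddCommGroup X] [NormedSpace ℝ X] (v w : X) {f : X → ℝ}
    (hf : ContDiff ℝ (⊤ : ℕ∞) f) : dd v (dd w f) = dd w (dd v f) := by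
  funext x
  have hd : DifferentiableAt ℝ (fderiv ℝ f) x :=
    (hf.fderiv_right (m := (⊤ : ℕ∞)) (by simp)).differentiable (by simp) x
  have e : ∀ v w : X, dd v (dd w f) x = fderiv ℝ (fderiv ℝ f) x v w := by
    intro v w
    unfold dd
    rw [fderiv_clm_apply hd (by fun_prop)]
    simp
  rw [e, e]
  exact ((hf.contDiffAt (x := x)).isSymmSndFDerivAt (by
    rw [minSmoothness_of_isRCLikeNormedField]; exact WithTop.coe_le_coe.2 (le_top : (2:ℕ∞) ≤ ⊤))) v w

lemma smooth_diff {X : Type*} [NormedAddCommGroup X] [NormedSpace ℝ X] {f : X → ℝ}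
    (hf : ContDiff ℝ (⊤ : ℕ∞) f) : Differentiable ℝ f := hf.differentiable (by simp)

lemma lapl_eq (f : EuclideanSpace ℝ (Fin n) → ℝ) :
    lapl n f = fun x => ∑ i, dd (EuclideanSpace.single i 1) (dd (EuclideanSpace.single i 1) f) x := rfl

lemma lapl_smooth {f : EuclideanSpace ℝ (Fin n) → ℝ} (hf : ContDiff ℝ (⊤ : ℕ∞) f) :
    ContDiff ℝ (⊤ : ℕ∞) (lapl n f) := by
  rw [lapl_eq]
  exact ContDiff.sum fun i _ => dd_smooth _ (dd_smooth _ hf)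

lemma ibp (ho : IsOpen Ω) (hb : Bornology.IsBounded Ω)
    {f g : EuclideanSpace ℝ (Fin n) → ℝ} (hf : ContDiff ℝ (⊤ : ℕ∞) f) (hg : ContDiff ℝ (⊤ : ℕ∞) g)
    (h0 : ∀ x ∈ frontier Ω, f x = 0) (v : EuclideanSpace ℝ (Fin n)) :
    ∫ x in Ω, f x * dd v g x = - ∫ x in Ω, dd v f x * g x := by
  have h := integral_fderiv_zero ho hb (h := fun x => f x * g x) ((hf.mul hg).of_le (by simp))
    (fun x hx => by simp [h0 x hx]) v
  have e : ∀ x, fderiv ℝ (fun x => f x * g x) x v = f x * dd v g x + dd v f x * g x := by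
    intro x
    rw [fderiv_fun_mul (smooth_diff hf x) (smooth_diff hg x)]
    simp [dd]; ring
  simp_rw [e] at h
  rw [integral_add] at h
  · linarith
  · exact integrableOn_of_cont hb (hf.continuous.mul (dd_smooth v hg).continuous)
  · exact integrableOn_of_cont hb ((dd_smooth v hf).continuous.mul hg.continuous)

lemma green1 (ho : IsOpen Ω) (hb : Bornology.IsBounded Ω)
    {f g : EuclideanSpace ℝ (Fin n) → ℝ} (hf : ContDiff ℝ (⊤ : ℕ∞) f) (hg : ContDiff ℝ (⊤ : ℕ∞) g)
    (h0 : ∀ x ∈ frontier Ω, f x = 0) :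
    ∫ x in Ω, f x * lapl n g x = - ∑ i, ∫ x in Ω, dd (EuclideanSpace.single i 1) f x * dd (EuclideanSpace.single i 1) g x := by
  rw [lapl_eq]
  simp_rw [Finset.mul_sum]
  rw [integral_finsetSum, ← Finset.sum_neg_distrib]
  · refine Finset.sum_congr rfl fun i _ => ?_
    exact ibp ho hb hf (dd_smooth _ hg) h0 _
  · intro i _
    exact integrableOn_of_cont hb (hf.continuous.mul (dd_smooth _ (dd_smooth _ hg)).continuous)

lemma green2 (ho : IsOpen Ω) (hb : Bornology.IsBounded Ω)
    {f g : EuclideanSpace ℝ (Fin n) → ℝ} (hf : ContDiff ℝ (⊤ : ℕ∞) f) (hg : ContDiff ℝ (⊤ : ℕ∞) g)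
    (h0 : ∀ x ∈ frontier Ω, f x = 0) (h1 : ∀ x ∈ frontier Ω, g x = 0) :
    ∫ x in Ω, f x * lapl n g x = ∫ x in Ω, lapl n f x * g x := by
  rw [green1 ho hb hf hg h0]
  have := green1 ho hb hg hf h1
  simp_rw [mul_comm (lapl n f _)]
  rw [this]
  simp_rw [mul_comm (dd _ f _)]

lemma poincare (hn : 1 ≤ n) (ho : IsOpen Ω) (hb : Bornology.IsBounded Ω) :
    ∃ R > 0, ∀ f : EuclideanSpace ℝ (Fin n) → ℝ, ContDiff ℝ (⊤ : ℕ∞) f → (∀ x ∈ frontier Ω, f x = 0) →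
      ∫ x in Ω, f x ^ 2 ≤ R * -(∫ x in Ω, f x * lapl n f x) := by
  obtain ⟨R, hR⟩ := hb.subset_closedBall (0 : EuclideanSpace ℝ (Fin n))
  have hR' : Ω ⊆ Metric.closedBall (0 : EuclideanSpace ℝ (Fin n)) (|R| + 1) :=
    hR.trans (Metric.closedBall_subset_closedBall (by linarith [le_abs_self R]))
  set B := |R| + 1 with hB
  have hBp : 0 < B := by positivity
  refine ⟨4*B^2, by positivity, fun f hf h0 => ?_⟩
  set i0 : Fin n := ⟨0, hn⟩
  set e : EuclideanSpace ℝ (Fin n) := EuclideanSpace.single i0 1 with he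
  have hx : ContDiff ℝ (⊤ : ℕ∞) (fun x : EuclideanSpace ℝ (Fin n) => x i0) := by fun_prop
  have hdx : dd e (fun x : EuclideanSpace ℝ (Fin n) => x i0) = fun _ => 1 := by
    funext x
    have : (fun x : EuclideanSpace ℝ (Fin n) => x i0) = (EuclideanSpace.proj i0 : EuclideanSpace ℝ (Fin n) →L[ℝ] ℝ) := by
      ext; simp
    unfold dd
    rw [this, ContinuousLinearMap.fderiv]
    simp [he]
  have h1 := ibp ho hb (hf.pow 2) hx (fun x hx => by simp [h0 x hx]) e
  rw [hdx] at h1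
  have hd2 : ∀ x, dd e (fun x => f x ^ 2) x = 2 * f x * dd e f x := by
    intro x
    unfold dd
    rw [fderiv_fun_pow _ (smooth_diff hf x)]
    simp
  have hc := hf.continuous
  have hdc := (dd_smooth e hf).continuous
  have hbound : ∫ x in Ω, f x ^ 2 ≤ ∫ x in Ω, (1/2 * f x ^2 + 2*B^2 * (dd e f x * dd e f x)) := by
    calc ∫ x in Ω, f x ^ 2 = - ∫ x in Ω, dd e (fun x => f x ^ 2) x * x i0 := by simpa using h1
      _ = ∫ x in Ω, - (2 * f x * dd e f x * x i0) := by
        rw [← integral_neg]; simp_rw [hd2]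
      _ ≤ _ := by
        apply setIntegral_mono_on
        · apply integrableOn_of_cont hb; fun_prop
        · apply integrableOn_of_cont hb; fun_prop
        · exact ho.measurableSet
        · intro x hx
          have h2 : |x i0| ≤ B := by
            have h3 : ‖x i0‖ ≤ ‖x‖ := PiLp.norm_apply_le x i0
            have h4 := hR' hx
            rw [mem_closedBall_zero_iff] at h4
            exact h3.trans h4
          have h5 : x i0 ^ 2 ≤ B^2 := sq_le_sq' (abs_le.1 h2).1 (abs_le.1 h2).2
          have h6 := mul_le_mul_of_nonneg_left h5 (sq_nonneg (dd e f x))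
          nlinarith [sq_nonneg (f x + 2 * (dd e f x * x i0))]
  rw [integral_add, integral_const_mul, integral_const_mul] at hbound
  · have hg := green1 ho hb hf hf h0
    have hle : ∫ x in Ω, dd e f x * dd e f x ≤ ∑ i, ∫ x in Ω, dd (EuclideanSpace.single i 1) f x * dd (EuclideanSpace.single i 1) f x :=
      Finset.single_le_sum (f := fun i => ∫ x in Ω, dd (EuclideanSpace.single i 1) f x * dd (EuclideanSpace.single i 1) f x)
        (fun i _ => integral_nonneg fun x => mul_self_nonneg _) (Finset.mem_univ i0)
    rw [hg, neg_neg]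
    have := mul_le_mul_of_nonneg_left hle (by positivity : 0 ≤ 4*B^2)
    linarith
  · apply integrableOn_of_cont hb; fun_prop
  · apply integrableOn_of_cont hb; fun_prop
end green

section pde
variable {n : ℕ} {Ω : Set (EuclideanSpace ℝ (Fin n))}

noncomputable def muK (Ω : Set (EuclideanSpace ℝ (Fin n))) : Measure (closure Ω) :=
  Measure.comap Subtype.val (volume.restrict Ω)

lemma muK_finite (hb : Bornology.IsBounded Ω) : IsFiniteMeasure (muK Ω) := by
  constructor
  unfold muK
  rw [(MeasurableEmbedding.subtype_coe isClosed_closure.measurableSet).comap_apply]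
  refine lt_of_le_of_lt (measure_mono (Set.subset_univ _)) ?_
  rw [Measure.restrict_apply_univ]
  exact hb.measure_lt_top

lemma muK_integral (f : EuclideanSpace ℝ (Fin n) → ℝ) :
    ∫ x, f (x : EuclideanSpace ℝ (Fin n)) ∂(muK Ω) = ∫ x in Ω, f x := by
  unfold muK
  rw [integral_subtype_comap isClosed_closure.measurableSet, Measure.restrict_restrict isClosed_closure.measurableSet,
    Set.inter_eq_right.2 subset_closure]

lemma gen_prim_hasDerivAt {X : Type*} [NormedAddCommGroup X] [NormedSpace ℝ X] [CompleteSpace X]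
    {f : ℝ → X} (hf : Continuous f) (c t : ℝ) :
    HasDerivAt (fun t => ∫ s in c..t, f s) (f t) t :=
  intervalIntegral.integral_hasDerivAt_right (hf.intervalIntegrable _ _)
    hf.stronglyMeasurable.stronglyMeasurableAtFilter hf.continuousAt

noncomputable def curveC (Ω : Set (EuclideanSpace ℝ (Fin n))) (G : C(EuclideanSpace ℝ (Fin n) × ℝ, ℝ)) (t : ℝ) :
    C(closure Ω, ℝ) := ⟨fun x => G (x, t), by fun_prop⟩

lemma curveC_cont (G : C(EuclideanSpace ℝ (Fin n) × ℝ, ℝ)) :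
    Continuous (curveC Ω G) := by
  apply ContinuousMap.continuous_of_continuous_uncurry
  unfold Function.uncurry
  simp only [curveC, ContinuousMap.coe_mk]
  fun_prop

lemma dd_time {U : EuclideanSpace ℝ (Fin n) × ℝ → ℝ} (hU : ContDiff ℝ (⊤ : ℕ∞) U)
    (x : EuclideanSpace ℝ (Fin n)) (t : ℝ) : HasDerivAt (fun s => U (x, s)) (dd (0, 1) U (x, t)) t := by
  have h1 : HasDerivAt (fun s : ℝ => (x, s)) ((0 : EuclideanSpace ℝ (Fin n)), (1:ℝ)) t :=
    (hasDerivAt_const t x).prodMk (hasDerivAt_id t)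
  exact ((smooth_diff hU (x,t)).hasFDerivAt).comp_hasDerivAt t h1

lemma curveC_hasDerivAt [CompactSpace (closure Ω)] (G G' : C(EuclideanSpace ℝ (Fin n) × ℝ, ℝ))
    (h : ∀ x t, HasDerivAt (fun s => G (x, s)) (G' (x, t)) t) (t : ℝ) :
    HasDerivAt (curveC Ω G) (curveC Ω G' t) t := by
  have h1 := (gen_prim_hasDerivAt (curveC_cont (Ω := Ω) G') 0 t).add_const (curveC Ω G 0)
  refine h1.congr_of_eventuallyEq (Filter.Eventually.of_forall fun s => ?_)
  ext x
  have e := (ContinuousMap.evalCLM ℝ x : C(closure Ω, ℝ) →L[ℝ] ℝ).intervalIntegral_comp_comm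
    ((curveC_cont (Ω := Ω) G').intervalIntegrable (μ := volume) 0 s)
  have e2 := intervalIntegral.integral_eq_sub_of_hasDerivAt (a := 0) (b := s) (fun r _ => h x r)
    (Continuous.intervalIntegrable (by fun_prop) _ _)
  have e3 : (∫ r in (0:ℝ)..s, curveC Ω G' r) x = ∫ r in (0:ℝ)..s, G' (x, r) := e.symm
  simp only [ContinuousMap.add_apply]
  rw [e3, e2]
  simp [curveC]

noncomputable def curve (Ω : Set (EuclideanSpace ℝ (Fin n))) [CompactSpace (closure Ω)] [IsFiniteMeasure (muK Ω)]
    (G : C(EuclideanSpace ℝ (Fin n) × ℝ, ℝ)) (t : ℝ) : Lp ℝ 2 (muK Ω) :=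
  ContinuousMap.toLp 2 (muK Ω) ℝ (curveC Ω G t)

section
variable [CompactSpace (closure Ω)] [IsFiniteMeasure (muK Ω)]

lemma curve_cont (G : C(EuclideanSpace ℝ (Fin n) × ℝ, ℝ)) : Continuous (curve Ω G) :=
  (ContinuousMap.toLp 2 (muK Ω) ℝ).continuous.comp (curveC_cont G)

lemma curve_hasDerivAt (G G' : C(EuclideanSpace ℝ (Fin n) × ℝ, ℝ))
    (h : ∀ x t, HasDerivAt (fun s => G (x, s)) (G' (x, t)) t) (t : ℝ) :
    HasDerivAt (curve Ω G) (curve Ω G' t) t :=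
  (ContinuousMap.toLp (E := ℝ) 2 (muK Ω) ℝ).hasFDerivAt.comp_hasDerivAt t (curveC_hasDerivAt G G' h t)

lemma curve_inner (F G : C(EuclideanSpace ℝ (Fin n) × ℝ, ℝ)) (t s : ℝ) :
    inner ℝ (curve Ω F t) (curve Ω G s) = ∫ x in Ω, F (x, t) * G (x, s) := by
  unfold curve
  rw [ContinuousMap.inner_toLp]
  rw [← muK_integral]
  refine integral_congr_ae (Filter.Eventually.of_forall fun x => ?_)
  simp [curveC, mul_comm]

lemma curve_norm (F : C(EuclideanSpace ℝ (Fin n) × ℝ, ℝ)) (t : ℝ) :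
    ‖curve Ω F t‖ ^ 2 = ∫ x in Ω, F (x, t) ^ 2 := by
  rw [← real_inner_self_eq_norm_sq, curve_inner]
  simp_rw [sq]
end

noncomputable def LL (U : EuclideanSpace ℝ (Fin n) × ℝ → ℝ) : EuclideanSpace ℝ (Fin n) × ℝ → ℝ :=
  fun q => ∑ i, dd (EuclideanSpace.single i 1, 0) (dd (EuclideanSpace.single i 1, 0) U) q

lemma LL_smooth {U : EuclideanSpace ℝ (Fin n) × ℝ → ℝ} (hU : ContDiff ℝ (⊤ : ℕ∞) U) :
    ContDiff ℝ (⊤ : ℕ∞) (LL U) :=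
  ContDiff.sum fun i _ => dd_smooth _ (dd_smooth _ hU)

lemma dd_slice {U : EuclideanSpace ℝ (Fin n) × ℝ → ℝ} (hU : ContDiff ℝ (⊤ : ℕ∞) U)
    (v : EuclideanSpace ℝ (Fin n)) (t : ℝ) : dd v (fun y => U (y, t)) = fun x => dd (v, 0) U (x, t) := by
  funext x
  have h1 : HasFDerivAt (fun y : EuclideanSpace ℝ (Fin n) => (y, t)) (ContinuousLinearMap.inl ℝ _ ℝ) x :=
    hasFDerivAt_prodMk_left x t
  have h2 := ((smooth_diff hU (x,t)).hasFDerivAt).comp x h1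
  have h3 : fderiv ℝ (fun y => U (y, t)) x = _ := h2.fderiv
  unfold dd
  rw [h3]
  simp

lemma lapl_slice {U : EuclideanSpace ℝ (Fin n) × ℝ → ℝ} (hU : ContDiff ℝ (⊤ : ℕ∞) U) (t : ℝ) :
    lapl n (fun y => U (y, t)) = fun x => LL U (x, t) := by
  rw [lapl_eq]
  funext x
  unfold LL
  refine Finset.sum_congr rfl fun i _ => ?_
  rw [dd_slice hU, dd_slice (dd_smooth _ hU)]

lemma dd_time_LL {U : EuclideanSpace ℝ (Fin n) × ℝ → ℝ} (hU : ContDiff ℝ (⊤ : ℕ∞) U) :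
    dd (0,1) (LL U) = LL (dd (0,1) U) := by
  funext q
  have : dd (0,1) (LL U) q = ∑ i, dd (0,1) (dd (EuclideanSpace.single i 1, 0) (dd (EuclideanSpace.single i 1, 0) U)) q := by
    have e : fderiv ℝ (LL U) q = ∑ i, fderiv ℝ (dd (EuclideanSpace.single i 1, 0) (dd (EuclideanSpace.single i 1, 0) U)) q :=
      fderiv_fun_sum (fun i _ => smooth_diff (dd_smooth _ (dd_smooth _ hU)) q)
    have e2 : dd (0,1) (LL U) q = fderiv ℝ (LL U) q (0,1) := rfl
    rw [e2, e, ContinuousLinearMap.sum_apply]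
    rfl
  rw [this]
  unfold LL
  refine Finset.sum_congr rfl fun i _ => ?_
  rw [dd_comm _ _ (dd_smooth _ hU), dd_comm _ (EuclideanSpace.single i 1, 0) hU]

lemma fubini_aux (hb : Bornology.IsBounded Ω) (G : C(EuclideanSpace ℝ (Fin n) × ℝ, ℝ)) :
    ∫ x in Ω, ∫ ρ in (0:ℝ)..1, G (x, ρ) = ∫ ρ in (0:ℝ)..1, ∫ x in Ω, G (x, ρ) := by
  simp_rw [intervalIntegral.integral_of_le zero_le_one]
  apply integral_integral_swap
  rw [Measure.prod_restrict]
  have : IsCompact (closure Ω ×ˢ Set.Icc (0:ℝ) 1) := hb.isCompact_closure.prod isCompact_Icc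
  exact (G.continuous.continuousOn.integrableOn_compact this).mono_set
    (Set.prod_mono subset_closure Set.Ioc_subset_Icc_self)


lemma green_slice (ho : IsOpen Ω) (hb : Bornology.IsBounded Ω)
    {F G : EuclideanSpace ℝ (Fin n) × ℝ → ℝ} (hF : ContDiff ℝ (⊤ : ℕ∞) F) (hG : ContDiff ℝ (⊤ : ℕ∞) G) (t s : ℝ)
    (h0 : ∀ x ∈ frontier Ω, F (x, t) = 0) (h1 : ∀ x ∈ frontier Ω, G (x, s) = 0) :
    ∫ x in Ω, F (x, t) * LL G (x, s) = ∫ x in Ω, LL F (x, t) * G (x, s) := by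
  have h := green2 ho hb (f := fun x => F (x, t)) (g := fun x => G (x, s)) (by fun_prop) (by fun_prop) h0 h1
  rw [lapl_slice hF, lapl_slice hG] at h
  exact h

lemma test_eq (ho : IsOpen Ω) (hb : Bornology.IsBounded Ω) {τ a t : ℝ}
    {F Z W P T : EuclideanSpace ℝ (Fin n) × ℝ → ℝ} (hF : ContDiff ℝ (⊤ : ℕ∞) F)
    (hW : ContDiff ℝ (⊤ : ℕ∞) W) (hP : ContDiff ℝ (⊤ : ℕ∞) P)
    (hT : ContDiff ℝ (⊤ : ℕ∞) T)
    (h : ∀ x ∈ Ω, Z (x, t) + LL W (x, t - τ) + a * LL P (x, t) + LL T (x, t) = 0)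
    (bF : ∀ x ∈ frontier Ω, F (x, t) = 0) (bW : ∀ x ∈ frontier Ω, W (x, t - τ) = 0)
    (bP : ∀ x ∈ frontier Ω, P (x, t) = 0) (bT : ∀ x ∈ frontier Ω, T (x, t) = 0) :
    ∫ x in Ω, F (x, t) * Z (x, t) = - (∫ x in Ω, LL F (x, t) * W (x, t - τ))
      - a * (∫ x in Ω, LL F (x, t) * P (x, t)) - ∫ x in Ω, LL F (x, t) * T (x, t) := by
  rw [← green_slice ho hb hF hW t _ bF bW, ← green_slice ho hb hF hP t t bF bP,
    ← green_slice ho hb hF hT t t bF bT]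
  have cF := hF.continuous
  have c1 := (LL_smooth hW).continuous
  have c2 := (LL_smooth hP).continuous
  have c3 := (LL_smooth hT).continuous
  rw [← integral_neg, ← integral_const_mul, ← integral_sub, ← integral_sub]
  · refine setIntegral_congr_fun ho.measurableSet fun x hx => ?_
    have := h x hx
    have e : Z (x, t) = - LL W (x, t - τ) - a * LL P (x, t) - LL T (x, t) := by linarith
    simp only [e]; ring
  all_goals apply integrableOn_of_cont hb
  all_goals fun_prop

lemma poincare2 (hb : Bornology.IsBounded Ω) {R : ℝ} (hR : 0 < R) {f g : EuclideanSpace ℝ (Fin n) → ℝ}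
    (hf : Continuous f) (hg : Continuous g)
    (h : ∫ x in Ω, f x ^ 2 ≤ R * -(∫ x in Ω, f x * g x)) :
    ∫ x in Ω, f x ^ 2 ≤ R ^ 2 * ∫ x in Ω, g x ^ 2 := by
  have h1 : R * -(∫ x in Ω, f x * g x) ≤ ∫ x in Ω, (1/2 * f x ^ 2 + R^2/2 * g x ^ 2) := by
    rw [← integral_neg, ← integral_const_mul]
    apply integral_mono
    · apply integrableOn_of_cont hb; fun_prop
    · apply integrableOn_of_cont hb; fun_prop
    · intro x
      simp only
      nlinarith [sq_nonneg (f x + R * g x)]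
  rw [integral_add, integral_const_mul, integral_const_mul] at h1
  · linarith
  all_goals (apply integrableOn_of_cont hb; fun_prop)

lemma deriv_zero_of_bc {U : EuclideanSpace ℝ (Fin n) × ℝ → ℝ} (hU : ContDiff ℝ (⊤ : ℕ∞) U)
    {x : EuclideanSpace ℝ (Fin n)} {τ t : ℝ} (ht : -τ < t) (h : ∀ s, -τ ≤ s → U (x, s) = 0) :
    dd (0, 1) U (x, t) = 0 := by
  have h1 := dd_time hU x t
  have h2 : (fun s => U (x, s)) =ᶠ[nhds t] fun _ => 0 := by
    filter_upwards [lt_mem_nhds ht] with s hs using h s hs.le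
  exact (h1.congr_of_eventuallyEq h2.symm).unique (hasDerivAt_const t 0)

/-- bundle a smooth function as a continuous map -/
def smC {X : Type*} [NormedAddCommGroup X] [NormedSpace ℝ X] (U : X → ℝ) (hU : ContDiff ℝ (⊤ : ℕ∞) U) : C(X, ℝ) :=
  ⟨U, hU.continuous⟩

lemma curve_sm_deriv [CompactSpace (closure Ω)] [IsFiniteMeasure (muK Ω)]
    {U U' : EuclideanSpace ℝ (Fin n) × ℝ → ℝ} (hU : ContDiff ℝ (⊤ : ℕ∞) U) (hU' : ContDiff ℝ (⊤ : ℕ∞) U')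
    (h : dd (0, 1) U = U') (t : ℝ) :
    HasDerivAt (curve Ω (smC U hU)) (curve Ω (smC U' hU') t) t := by
  subst h
  exact curve_hasDerivAt _ _ (fun x t => dd_time hU x t) t

lemma sol_absSys [CompactSpace (closure Ω)] [IsFiniteMeasure (muK Ω)]
    (ho : IsOpen Ω) (hb : Bornology.IsBounded Ω) {τ a R : ℝ} (hτ : 0 < τ) (hR : 0 < R)
    (hp : ∀ f : EuclideanSpace ℝ (Fin n) → ℝ, ContDiff ℝ (⊤ : ℕ∞) f → (∀ x ∈ frontier Ω, f x = 0) →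
      ∫ x in Ω, f x ^ 2 ≤ R * -(∫ x in Ω, f x * lapl n f x))
    {U V Z W P T Y : EuclideanSpace ℝ (Fin n) × ℝ → ℝ}
    (hU : ContDiff ℝ (⊤ : ℕ∞) U) (hV : ContDiff ℝ (⊤ : ℕ∞) V) (hZ : ContDiff ℝ (⊤ : ℕ∞) Z)
    (hW : ContDiff ℝ (⊤ : ℕ∞) W) (hP : ContDiff ℝ (⊤ : ℕ∞) P) (hT : ContDiff ℝ (⊤ : ℕ∞) T)
    (hY : ContDiff ℝ (⊤ : ℕ∞) Y)
    (eV : dd (0, 1) U = V) (eZ : dd (0, 1) V = Z) (eW : LL U = W) (eP : LL V = P) (eY : dd (0, 1) T = Y)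
    (h1 : ∀ x ∈ Ω, ∀ t > 0, Z (x, t) + LL W (x, t - τ) + a * LL P (x, t) + LL T (x, t) = 0)
    (h2 : ∀ x ∈ Ω, ∀ t > 0, Y (x, t) - LL T (x, t) - P (x, t) = 0)
    (bU : ∀ x ∈ frontier Ω, ∀ t, -τ ≤ t → U (x, t) = 0)
    (bW : ∀ x ∈ frontier Ω, ∀ t, -τ ≤ t → W (x, t) = 0)
    (bT : ∀ x ∈ frontier Ω, ∀ t, 0 ≤ t → T (x, t) = 0) :
    AbsSys τ a (1/R) (R^2) (curve Ω (smC U hU)) (curve Ω (smC V hV)) (curve Ω (smC Z hZ))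
      (curve Ω (smC W hW)) (curve Ω (smC P hP)) (curve Ω (smC T hT)) (curve Ω (smC Y hY)) := by
  have eWP : dd (0, 1) W = P := by rw [← eW, dd_time_LL hU, eV, eP]
  have bV : ∀ x ∈ frontier Ω, ∀ t, -τ < t → V (x, t) = 0 := fun x hx t ht => by
    rw [← eV]; exact deriv_zero_of_bc hU ht (bU x hx)
  have bP : ∀ x ∈ frontier Ω, ∀ t, -τ < t → P (x, t) = 0 := fun x hx t ht => by
    rw [← eWP]; exact deriv_zero_of_bc hW ht (bW x hx)
  have poin : ∀ {F : EuclideanSpace ℝ (Fin n) × ℝ → ℝ}, ContDiff ℝ (⊤ : ℕ∞) F → ∀ t,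
      (∀ x ∈ frontier Ω, F (x, t) = 0) →
      ∫ x in Ω, F (x, t) ^ 2 ≤ R * -(∫ x in Ω, F (x, t) * LL F (x, t)) := by
    intro F hF t h0
    have := hp (fun x => F (x, t)) (by fun_prop) h0
    rw [lapl_slice hF] at this
    exact this
  refine ⟨curve_sm_deriv _ _ eV, curve_sm_deriv _ _ eZ, curve_sm_deriv _ _ eWP, curve_sm_deriv _ _ eY,
    curve_cont _, ?_, ?_, ?_, ?_, ?_⟩
  · intro t ht
    have := test_eq ho hb (F := V) (τ := τ) (a := a) (t := t) hV hW hP hT (fun x hx => h1 x hx t ht)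
      (fun x hx => bV x hx t (by linarith)) (fun x hx => bW x hx _ (by linarith))
      (fun x hx => bP x hx t (by linarith)) (fun x hx => bT x hx t ht.le)
    rw [eP] at this
    simp only [curve_inner, curve_norm, smC, ContinuousMap.coe_mk]
    simp only [sq]
    exact this
  · intro t ht
    have hq := poin hT t (fun x hx => bT x hx t ht.le)
    simp only [curve_inner, curve_norm, smC, ContinuousMap.coe_mk]
    have cT := hT.continuous
    have cL := (LL_smooth hT).continuous
    have cP := hP.continuous
    have e : ∫ x in Ω, T (x, t) * Y (x, t) = (∫ x in Ω, T (x, t) * LL T (x, t)) + ∫ x in Ω, P (x, t) * T (x, t) := by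
      rw [← integral_add]
      · refine setIntegral_congr_fun ho.measurableSet fun x hx => ?_
        have e : Y (x, t) = LL T (x, t) + P (x, t) := by linarith [h2 x hx t ht]
        simp only [e]; ring
      all_goals (apply integrableOn_of_cont hb; fun_prop)
    rw [e]
    have : (1/R) * ∫ x in Ω, T (x, t) ^ 2 ≤ -(∫ x in Ω, T (x, t) * LL T (x, t)) := by
      rw [one_div, inv_mul_le_iff₀ hR]; exact hq
    linarith
  · intro t ht
    have := test_eq ho hb (F := U) (τ := τ) (a := a) (t := t) hU hW hP hT (fun x hx => h1 x hx t ht)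
      (fun x hx => bU x hx t (by linarith)) (fun x hx => bW x hx _ (by linarith))
      (fun x hx => bP x hx t (by linarith)) (fun x hx => bT x hx t ht.le)
    rw [eW] at this
    simp only [curve_inner, smC, ContinuousMap.coe_mk]
    exact this
  · intro t ht
    simp only [curve_norm, smC, ContinuousMap.coe_mk]
    have := poin hV t (fun x hx => bV x hx t (by linarith))
    rw [eP] at this
    have cV := hV.continuous
    have cP := hP.continuous
    exact poincare2 hb hR (f := fun x => V (x, t)) (g := fun x => P (x, t)) (by fun_prop) (by fun_prop) this
  · intro t ht
    simp only [curve_norm, smC, ContinuousMap.coe_mk]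
    have := poin hU t (fun x hx => bU x hx t (by linarith))
    rw [eW] at this
    have cV := hU.continuous
    have cP := hW.continuous
    exact poincare2 hb hR (f := fun x => U (x, t)) (g := fun x => W (x, t)) (by fun_prop) (by fun_prop) this

lemma energy_eq [CompactSpace (closure Ω)] [IsFiniteMeasure (muK Ω)]
    (hb : Bornology.IsBounded Ω) {τ ξ : ℝ} (hτ : 0 < τ)
    {u θ : EuclideanSpace ℝ (Fin n) → ℝ → ℝ}
    {V W T : EuclideanSpace ℝ (Fin n) × ℝ → ℝ}
    (hV : ContDiff ℝ (⊤ : ℕ∞) V)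
    (hW : ContDiff ℝ (⊤ : ℕ∞) W) (hT : ContDiff ℝ (⊤ : ℕ∞) T)
    (eV : ∀ x t, deriv (u x) t = V (x, t)) (eW : ∀ x t, lapl n (fun y => u y t) x = W (x, t))
    (eT : ∀ x t, θ x t = T (x, t)) (t : ℝ) :
    energyKVPlate n Ω τ ξ u θ t = E0 (curve Ω (smC V hV)) (curve Ω (smC W hW)) (curve Ω (smC T hT)) t
      + ξ / (2 * τ) * ∫ s in (t-τ)..t, ‖curve Ω (smC W hW) s‖ ^ 2 := by
  have cV := hV.continuous
  have cW := hW.continuous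
  have cT := hT.continuous
  unfold energyKVPlate E0
  simp_rw [eV, eW, eT]
  have f := fubini_aux hb ⟨fun q => W (q.1, t - τ * q.2) ^ 2, by fun_prop⟩
  simp only [ContinuousMap.coe_mk] at f
  rw [f]
  have g := intervalIntegral.integral_comp_sub_mul (a := 0) (b := 1)
    (fun s => ∫ x in Ω, W (x, s) ^ 2) hτ.ne' t
  rw [g]
  simp only [curve_norm, smC, ContinuousMap.coe_mk]
  rw [integral_add, integral_add]
  · simp only [mul_one, mul_zero, sub_zero, smul_eq_mul]
    field_simp
  all_goals apply integrableOn_of_cont hb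
  all_goals fun_prop
end pde


/-- Exponential stability of the delayed thermoelastic plate with Kelvin–Voigt
damping when `0 < τ ≤ a` and `ξ ≥ 2τ/a`. -/
theorem exponential_stability_KVplate
    (n : ℕ) (hn : 1 ≤ n) (Ω : Set (EuclideanSpace ℝ (Fin n)))
    (hΩopen : IsOpen Ω) (hΩbdd : Bornology.IsBounded Ω)
    (τ a ξ : ℝ) (hτ : 0 < τ) (hτa : τ ≤ a) (hξ : 2 * τ / a ≤ ξ) :
    ∃ C > (0 : ℝ), ∃ w > (0 : ℝ), ∀ u θ : EuclideanSpace ℝ (Fin n) → ℝ → ℝ,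
      IsSmoothSolKVPlate n Ω τ a u θ →
      ∀ t ≥ (0 : ℝ),
        energyKVPlate n Ω τ ξ u θ t ≤
          C * Real.exp (-w * t) * energyKVPlate n Ω τ ξ u θ 0 := by
  classical
  haveI : CompactSpace (closure Ω) := isCompact_iff_compactSpace.1 hΩbdd.isCompact_closure
  haveI : IsFiniteMeasure (muK Ω) := muK_finite hΩbdd
  obtain ⟨R, hR, hp⟩ := poincare hn hΩopen hΩbdd
  have ha : 0 < a := lt_of_lt_of_le hτ hτa
  obtain ⟨M, hM, ω, hω, hst⟩ := abs_stability (H := Lp ℝ 2 (muK Ω)) (τ := τ) (a := a)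
    (c0 := 1/R) (C := R^2) hτ hτa (by positivity) (by positivity)
  have hξ0 : 0 < ξ := lt_of_lt_of_le (by positivity) hξ
  rw [div_le_iff₀ ha] at hξ
  have hk : 1 ≤ ξ * a / (2 * τ) := by
    rw [le_div_iff₀ (by positivity)]; linarith
  refine ⟨ξ * a / (2 * τ) * M, by positivity, ω, hω, fun u θ S t ht => ?_⟩
  have hU := S.smooth_u
  have hT := S.smooth_θ
  obtain ⟨U, hUd⟩ : ∃ U : EuclideanSpace ℝ (Fin n) × ℝ → ℝ, U = fun p => u p.1 p.2 := ⟨_, rfl⟩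
  obtain ⟨T, hTd⟩ : ∃ T : EuclideanSpace ℝ (Fin n) × ℝ → ℝ, T = fun p => θ p.1 p.2 := ⟨_, rfl⟩
  rw [← hUd] at hU
  rw [← hTd] at hT
  have eu : ∀ x s, u x s = U (x, s) := fun x s => by rw [hUd]
  have eT : ∀ x s, θ x s = T (x, s) := fun x s => by rw [hTd]
  have hV := dd_smooth (0, 1) hU
  have hZ := dd_smooth (0, 1) hV
  have hY := dd_smooth (0, 1) hT
  have hW := LL_smooth hU
  have hP := LL_smooth hV
  have eV : ∀ x s, deriv (u x) s = dd (0, 1) U (x, s) := fun x s => by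
    have : u x = fun s => U (x, s) := funext fun s => eu x s
    rw [this]; exact (dd_time hU x s).deriv
  have eY : ∀ x s, deriv (θ x) s = dd (0, 1) T (x, s) := fun x s => by
    have : θ x = fun s => T (x, s) := funext fun s => eT x s
    rw [this]; exact (dd_time hT x s).deriv
  have eZ : ∀ x s, deriv (deriv (u x)) s = dd (0, 1) (dd (0, 1) U) (x, s) := fun x s => by
    have : deriv (u x) = fun s => dd (0, 1) U (x, s) := funext fun s => eV x s
    rw [this]; exact (dd_time hV x s).deriv
  have eW : ∀ x s, lapl n (fun y => u y s) x = LL U (x, s) := fun x s => by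
    have : (fun y => u y s) = fun y => U (y, s) := funext fun y => eu y s
    rw [this, lapl_slice hU]
  have eLT : ∀ x s, lapl n (fun y => θ y s) x = LL T (x, s) := fun x s => by
    have : (fun y => θ y s) = fun y => T (y, s) := funext fun y => eT y s
    rw [this, lapl_slice hT]
  have eP : ∀ x s, lapl n (fun y => deriv (u y) s) x = LL (dd (0, 1) U) (x, s) := fun x s => by
    have : (fun y => deriv (u y) s) = fun y => dd (0, 1) U (y, s) := funext fun y => eV y s
    rw [this, lapl_slice hV]
  have A := sol_absSys (τ := τ) (a := a) hΩopen hΩbdd hτ hR hp hU hV hZ hW hP hT hY rfl rfl rfl rfl rfl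
    (fun x hx t ht => by
      have h := S.pde_u x hx t ht
      simp_rw [eW, eP, eLT] at h
      rw [eZ, lapl_slice hW, lapl_slice hP] at h
      exact h)
    (fun x hx t ht => by
      have h := S.pde_θ x hx t ht
      rw [eY, eLT, eP] at h
      exact h)
    (fun x hx t ht => by rw [← eu]; exact (S.bc_u x hx t ht).1)
    (fun x hx t ht => by rw [← eW]; exact (S.bc_u x hx t ht).2)
    (fun x hx t ht => by rw [← eT]; exact S.bc_θ x hx t ht)
  have hmain := hst _ _ _ _ _ _ _ A t ht
  rw [energy_eq hΩbdd hτ hV hW hT eV eW eT, energy_eq hΩbdd hτ hV hW hT eV eW eT]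
  unfold E1 at hmain
  have nonneg : ∀ t, 0 ≤ E0 (curve Ω (smC _ hV)) (curve Ω (smC _ hW)) (curve Ω (smC _ hT)) t := fun t => by
    unfold E0; positivity
  have nonnegI : ∀ t, 0 ≤ ∫ s in (t-τ)..t, ‖curve Ω (smC _ hW) s‖ ^ 2 := fun t =>
    intervalIntegral.integral_nonneg (by linarith) fun s _ => by positivity
  have hc : ξ / (2 * τ) = ξ * a / (2 * τ) * (1 / a) := by field_simp
  set k := ξ * a / (2 * τ) with hkd
  rw [hc]
  have n1 := nonneg t
  have n2 := nonneg 0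
  have i2 := nonnegI 0
  generalize E0 (curve Ω (smC _ hV)) (curve Ω (smC _ hW)) (curve Ω (smC _ hT)) t = X1 at *
  generalize E0 (curve Ω (smC _ hV)) (curve Ω (smC _ hW)) (curve Ω (smC _ hT)) 0 = X0 at *
  generalize (∫ s in (t-τ)..t, ‖curve Ω (smC _ hW) s‖ ^ 2) = I1 at *
  generalize (∫ s in ((0:ℝ)-τ)..0, ‖curve Ω (smC _ hW) s‖ ^ 2) = I0 at *
  have hia : 0 < 1 / a := by positivity
  have hexp := Real.exp_pos (-ω * t)
  have hJ : 0 ≤ 1 / a * I0 := by positivity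
  calc X1 + k * (1 / a) * I1 ≤ k * (X1 + 1 / a * I1) := by nlinarith
    _ ≤ k * (M * Real.exp (-ω * t) * (X0 + 1 / a * I0)) := by gcongr
    _ = k * M * Real.exp (-ω * t) * (X0 + 1 / a * I0) := by ring
    _ ≤ k * M * Real.exp (-ω * t) * (X0 + k * (1 / a) * I0) := by
      gcongr
      exact le_mul_of_one_le_left hia.le hk
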